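/- For every ε > 0 there exists x₀ > 0 such that for all real x ≥ x₀, the number of fundamental discriminants D with 0 < D < x, D ≡ 1 (mod 3), and such that 3 does not divide the class number h(−D) of the imaginary quadratic field ℚ(√−D), is at least (9/(16π²) − ε)·x. -/

import Mathlib

open scoped Real
open IntermediateField

/-- `D` is a fundamental discriminant. -/
def IsFundamentalDiscriminant (D : ℤ) : Prop :=
  (D % 4 = 1 ∧ Squarefree D) ∨
    ∃ m : ℤ, D = 4 * m ∧ Squarefree m ∧ (m % 4 = 2 ∨ m % 4 = 3)

section QuadraticRing

variable {R : Type*} [CommRing R]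
  {φ : R →+* ℂ} {τ : R}

/-- In a quadratic ring `ℤ[τ]` the coordinates with respect to `1, τ` form a basis. -/
noncomputable def quadraticBasis (hτ : (φ τ).im ≠ 0) (hgen : ∀ z : R, ∃ x y : ℤ, z = x + y * τ) :
    Module.Basis (Fin 2) ℤ R :=
  Module.Basis.mk (v := ![1, τ])
    (by
      rw [LinearIndependent.pair_iff]
      intro s t h
      have h' := congrArg φ h
      simp only [zsmul_eq_mul, mul_one, map_add, map_intCast, map_mul, map_zero] at h'
      have him := congrArg Complex.im h'
      have hre := congrArg Complex.re h'
      simp at him hre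
      have ht : t = 0 := by tauto
      subst ht
      simpa using hre)
    (by
      intro z _
      obtain ⟨x, y, rfl⟩ := hgen z
      rw [Matrix.range_cons, Matrix.range_cons, Matrix.range_empty, Set.union_empty,
        Set.singleton_union, Submodule.mem_span_pair]
      exact ⟨x, y, by simp⟩)

theorem quadraticBasis_repr_im (hτ : (φ τ).im ≠ 0)
    (hgen : ∀ z : R, ∃ x y : ℤ, z = x + y * τ) (z : R) :
    φ z = ((quadraticBasis hτ hgen).repr z 0 : ℂ) +
      ((quadraticBasis hτ hgen).repr z 1 : ℂ) * φ τ := by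
  have h := (quadraticBasis hτ hgen).sum_repr z
  conv_lhs => rw [← h]
  simp [Fin.sum_univ_two, quadraticBasis]

/-- The covolume of an ideal of a quadratic ring. -/
theorem abs_im_conj_mul_eq_absNorm_mul [IsDedekindDomain R] [Module.Free ℤ R]
    [Module.Finite ℤ R] (hτ : (φ τ).im ≠ 0)
    (hgen : ∀ z : R, ∃ x y : ℤ, z = x + y * τ) (J : Ideal R) (bJ : Module.Basis (Fin 2) ℤ J) :
    |((starRingEnd ℂ) (φ (bJ 0)) * φ (bJ 1)).im| = Ideal.absNorm J * |(φ τ).im| := by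
  rw [← Ideal.natAbs_det_basis_change (quadraticBasis hτ hgen) J bJ, Nat.cast_natAbs,
    Module.Basis.det_apply, Matrix.det_fin_two]
  simp only [Module.Basis.toMatrix_apply, Function.comp]
  rw [quadraticBasis_repr_im hτ hgen (bJ 0), quadraticBasis_repr_im hτ hgen (bJ 1)]
  push_cast
  rw [← abs_mul]
  congr 1
  simp
  ring

theorem normSq_eq_absNorm_span [IsDedekindDomain R] [Module.Free ℤ R]
    [Module.Finite ℤ R] (hτ : (φ τ).im ≠ 0)
    (hgen : ∀ z : R, ∃ x y : ℤ, z = x + y * τ) {δ : R} (hδ : δ ≠ 0) :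
    Complex.normSq (φ δ) = Ideal.absNorm (Ideal.span {δ}) := by
  have h := abs_im_conj_mul_eq_absNorm_mul hτ hgen (Ideal.span {δ})
    (Ideal.basisSpanSingleton (quadraticBasis hτ hgen) hδ)
  have h0 : (quadraticBasis hτ hgen) 0 = 1 := by simp [quadraticBasis]
  have h1 : (quadraticBasis hτ hgen) 1 = τ := by simp [quadraticBasis]
  simp only [Ideal.basisSpanSingleton_apply, h0, h1, mul_one, map_mul] at h
  rw [← mul_assoc, mul_comm ((starRingEnd ℂ) _), Complex.mul_conj, Complex.im_ofReal_mul, abs_mul,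
    abs_of_nonneg (Complex.normSq_nonneg _)] at h
  exact mul_right_cancel₀ (abs_ne_zero.2 hτ) h

/-- If `I ^ 3 = (δ)` and some `α ∈ I` has `α ^ 3 = k ^ 3 δ` with `k` a nonzero integer, then `I` is
principal. -/
theorem isPrincipal_of_cube_eq_int_mul [IsDedekindDomain R] {I : Ideal R} {δ α : R} {k : ℤ}
    (hk : (k : R) ≠ 0) (hI : I ≠ ⊥) (hδ : I ^ 3 = Ideal.span {δ}) (h : α ^ 3 = δ * (k : R) ^ 3) :
    I.IsPrincipal := by
  have hcube : (I * Ideal.span {(k : R)}) ^ 3 = Ideal.span {α} ^ 3 := by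
    rw [mul_pow, hδ, Ideal.span_singleton_pow, Ideal.span_singleton_pow,
      Ideal.span_singleton_mul_span_singleton, h]
  have heq : I * Ideal.span {(k : R)} = Ideal.span {α} :=
    dvd_antisymm
      ((UniqueFactorizationMonoid.pow_dvd_pow_iff_dvd three_ne_zero).1 hcube.dvd)
      ((UniqueFactorizationMonoid.pow_dvd_pow_iff_dvd three_ne_zero).1 hcube.symm.dvd)
  have hk' : Ideal.span {(k : R)} ≠ ⊥ := by simpa using hk
  have hα : Ideal.span {α} ≠ ⊥ := heq ▸ mul_ne_zero hI hk'
  have hI0 := mem_nonZeroDivisors_of_ne_zero hI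
  have hk0 := mem_nonZeroDivisors_of_ne_zero hk'
  have hα0 := mem_nonZeroDivisors_of_ne_zero hα
  rw [← ClassGroup.mk0_eq_one_iff hI0]
  have h1 : ClassGroup.mk0 ⟨_, hk0⟩ = 1 := (ClassGroup.mk0_eq_one_iff hk0).2 ⟨⟨_, rfl⟩⟩
  have h2 : ClassGroup.mk0 ⟨_, hα0⟩ = 1 := (ClassGroup.mk0_eq_one_iff hα0).2 ⟨⟨_, rfl⟩⟩
  have h3 : (⟨I, hI0⟩ * ⟨_, hk0⟩ : nonZeroDivisors (Ideal R)) = ⟨_, hα0⟩ := Subtype.ext heq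
  rw [← h2, ← h3, map_mul, h1, mul_one]

theorem exists_sq_and_cube_of_cube_eq_sq {A n : ℤ} (hA : A ≠ 0) (h : A ^ 3 = n ^ 2) :
    ∃ k : ℤ, k ≠ 0 ∧ n = k ^ 3 := by
  obtain ⟨k, rfl⟩ : A ∣ n := by
    rw [← Int.pow_dvd_pow_iff two_ne_zero]
    exact ⟨A, by rw [← h]; ring⟩
  have hAk : A = k ^ 2 := by
    have : A ^ 2 * A = A ^ 2 * k ^ 2 := by linear_combination h
    exact mul_left_cancel₀ (pow_ne_zero 2 hA) this
  refine ⟨k, ?_, by rw [hAk]; ring⟩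
  rintro rfl
  simp [hAk] at hA

theorem im_mul_conj_of_eq (δ : R) (x y : ℤ) :
    (φ (δ * (x + y * τ)) * (starRingEnd ℂ) (φ δ)).im = Complex.normSq (φ δ) * (φ τ).im * y := by
  simp [Complex.normSq_apply]
  ring

/-- The cubic form attached to an ideal `I` of a quadratic ring with `I ^ 3 = (δ)` and a basis
`α, β` of `I`; its Hessian is the norm form of `I`. -/
theorem exists_cubic_form_of_basis [IsDedekindDomain R] [Module.Free ℤ R]
    [Module.Finite ℤ R] (hτ : (φ τ).im ≠ 0)
    (hgen : ∀ z : R, ∃ x y : ℤ, z = x + y * τ) (hφ : Function.Injective φ) {I : Ideal R}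
    (hI : I ≠ ⊥) (hIp : ¬ I.IsPrincipal) {δ : R} (hδ : I ^ 3 = Ideal.span {δ}) {α β : R}
    (hα : α ∈ I) (hβ : β ∈ I)
    (hαβ : |((starRingEnd ℂ) (φ α) * φ β).im| = Ideal.absNorm I * |(φ τ).im|) :
    ∃ a b c d : ℤ, a ≠ 0 ∧ d ≠ 0 ∧
      (Ideal.absNorm I : ℝ) * ((b ^ 2 - a * c : ℤ) : ℝ) = Complex.normSq (φ α) ∧
      (Ideal.absNorm I : ℝ) * ((b * c - a * d : ℤ) : ℝ) =
        2 * ((starRingEnd ℂ) (φ α) * φ β).re ∧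
      (Ideal.absNorm I : ℝ) * ((c ^ 2 - b * d : ℤ) : ℝ) = Complex.normSq (φ β) := by
  have hδ0 : δ ≠ 0 := by
    rintro rfl
    rw [Ideal.span_singleton_eq_bot.2 rfl] at hδ
    exact hI (pow_eq_zero_iff three_ne_zero |>.1 hδ)
  have hN : Complex.normSq (φ δ) = (Ideal.absNorm I : ℝ) ^ 3 := by
    rw [normSq_eq_absNorm_span hτ hgen hδ0, ← hδ, map_pow]
    push_cast
    rfl
  have hN0 : (Ideal.absNorm I : ℝ) ≠ 0 := by
    intro h
    rw [h] at hN
    simp [hδ0, map_eq_zero_iff φ hφ] at hN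
  have hcoef : ∀ x ∈ I, ∀ y ∈ I, ∀ z ∈ I, ∃ r s : ℤ, x * y * z = δ * (r + s * τ) := by
    intro x hx y hy z hz
    have : x * y * z ∈ I ^ 3 := by
      rw [pow_succ, pow_two]
      exact Ideal.mul_mem_mul (Ideal.mul_mem_mul hx hy) hz
    rw [hδ, Ideal.mem_span_singleton'] at this
    obtain ⟨w, hw⟩ := this
    obtain ⟨r, s, rfl⟩ := hgen w
    exact ⟨r, s, by rw [← hw, mul_comm]⟩
  obtain ⟨a', a, ha⟩ := hcoef α hα α hα α hα
  obtain ⟨b', b, hb⟩ := hcoef α hα α hα β hβ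
  obtain ⟨c', c, hc⟩ := hcoef α hα β hβ β hβ
  obtain ⟨d', d, hd⟩ := hcoef β hβ β hβ β hβ
  have Ea := im_mul_conj_of_eq (φ := φ) (τ := τ) δ a' a
  have Eb := im_mul_conj_of_eq (φ := φ) (τ := τ) δ b' b
  have Ec := im_mul_conj_of_eq (φ := φ) (τ := τ) δ c' c
  have Ed := im_mul_conj_of_eq (φ := φ) (τ := τ) δ d' d
  rw [← ha] at Ea
  rw [← hb] at Eb
  rw [← hc] at Ec
  rw [← hd] at Ed
  simp only [map_mul] at Ea Eb Ec Ed
  have hsq : ((starRingEnd ℂ) (φ α) * φ β).im ^ 2 = (Ideal.absNorm I : ℝ) ^ 2 * (φ τ).im ^ 2 := by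
    rw [← sq_abs, hαβ, mul_pow, sq_abs]
  set N : ℝ := (Ideal.absNorm I : ℝ) with hNdef
  rw [hN] at Ea Eb Ec Ed
  set t := (φ τ).im with ht
  have hK : N ^ 5 * t ^ 2 ≠ 0 := by positivity
  have hA : N * ((b ^ 2 - a * c : ℤ) : ℝ) = Complex.normSq (φ α) := by
    apply mul_left_cancel₀ hK
    have e : (N ^ 3 * t * b) ^ 2 - (N ^ 3 * t * a) * (N ^ 3 * t * c) =
        N ^ 3 * Complex.normSq (φ α) * (N ^ 2 * t ^ 2) := by
      rw [← Ea, ← Eb, ← Ec, ← hsq, ← hN]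
      simp [Complex.normSq_apply]
      ring
    push_cast
    linear_combination e
  have hB : N * ((b * c - a * d : ℤ) : ℝ) = 2 * ((starRingEnd ℂ) (φ α) * φ β).re := by
    apply mul_left_cancel₀ hK
    have e : (N ^ 3 * t * b) * (N ^ 3 * t * c) - (N ^ 3 * t * a) * (N ^ 3 * t * d) =
        N ^ 3 * (2 * ((starRingEnd ℂ) (φ α) * φ β).re) * (N ^ 2 * t ^ 2) := by
      rw [← Ea, ← Eb, ← Ec, ← Ed, ← hsq, ← hN]
      simp [Complex.normSq_apply]
      ring
    push_cast
    linear_combination e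
  have hC : N * ((c ^ 2 - b * d : ℤ) : ℝ) = Complex.normSq (φ β) := by
    apply mul_left_cancel₀ hK
    have e : (N ^ 3 * t * c) ^ 2 - (N ^ 3 * t * b) * (N ^ 3 * t * d) =
        N ^ 3 * Complex.normSq (φ β) * (N ^ 2 * t ^ 2) := by
      rw [← Ed, ← Eb, ← Ec, ← hsq, ← hN]
      simp [Complex.normSq_apply]
      ring
    push_cast
    linear_combination e
  have key : ∀ (γ : R) (A n : ℤ), N * A = Complex.normSq (φ γ) → φ γ ≠ 0 →
      γ * γ * γ = δ * (n + (0 : ℤ) * τ) → False := by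
    intro γ A n h1 h2 h3
    have hA0 : A ≠ 0 := by
      rintro rfl
      rw [Int.cast_zero, mul_zero, eq_comm, Complex.normSq_eq_zero] at h1
      exact h2 h1
    have h4 : (A : ℝ) ^ 3 = n ^ 2 := by
      have h5 := congrArg (fun z => Complex.normSq (φ z)) h3
      simp only [map_mul, Int.cast_zero, zero_mul, add_zero, map_intCast, hN, ← h1] at h5
      rw [← Complex.ofReal_intCast, Complex.normSq_ofReal] at h5
      apply mul_left_cancel₀ (pow_ne_zero 3 hN0)
      linear_combination h5
    obtain ⟨k, hk, rfl⟩ := exists_sq_and_cube_of_cube_eq_sq hA0 (by exact_mod_cast h4)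
    refine hIp (isPrincipal_of_cube_eq_int_mul (k := k) (α := γ) ?_ hI hδ ?_)
    · intro h
      have := congrArg φ h
      simp [hk] at this
    · push_cast at h3
      linear_combination h3
  have hne : ((starRingEnd ℂ) (φ α) * φ β).im ≠ 0 := by
    rw [← abs_ne_zero, hαβ]
    exact mul_ne_zero hN0 (abs_ne_zero.2 hτ)
  refine ⟨a, b, c, d, ?_, ?_, hA, hB, hC⟩
  · rintro rfl
    exact key α _ a' hA (fun h => hne (by simp [h])) ha
  · rintro rfl
    exact key β _ d' hC (fun h => hne (by simp [h])) hd

/-- A nonprincipal ideal with principal cube yields a cubic form with reduced Hessian whose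
discriminant is the discriminant of the ring. -/
theorem exists_reduced_cubic_form [IsDedekindDomain R] [Module.Free ℤ R]
    [Module.Finite ℤ R] (hτ : (φ τ).im ≠ 0)
    (hgen : ∀ z : R, ∃ x y : ℤ, z = x + y * τ) (hφ : Function.Injective φ) {I : Ideal R}
    (hI : I ≠ ⊥) (hIp : ¬ I.IsPrincipal) {δ : R} (hδ : I ^ 3 = Ideal.span {δ}) :
    ∃ a b c d : ℤ, a ≠ 0 ∧ d ≠ 0 ∧ |b * c - a * d| ≤ b ^ 2 - a * c ∧
      b ^ 2 - a * c ≤ c ^ 2 - b * d ∧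
      (((b * c - a * d) ^ 2 - 4 * (b ^ 2 - a * c) * (c ^ 2 - b * d) : ℤ) : ℝ) =
        -4 * (φ τ).im ^ 2 := by
  let good : R → R → Prop := fun α β => α ∈ I ∧ β ∈ I ∧
    |((starRingEnd ℂ) (φ α) * φ β).im| = Ideal.absNorm I * |(φ τ).im|
  have hform : ∀ α β, good α β → _ := fun α β h =>
    exists_cubic_form_of_basis hτ hgen hφ hI hIp hδ h.1 h.2.1 h.2.2
  have hNpos : (0 : ℝ) < Ideal.absNorm I := by
    have : Ideal.absNorm I ≠ 0 := by simpa [Ideal.absNorm_eq_zero_iff] using hI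
    positivity
  have hex : ∃ n : ℕ, ∃ α β, good α β ∧
      Complex.normSq (φ α) + Complex.normSq (φ β) = Ideal.absNorm I * n := by
    let bI := Ideal.selfBasis (quadraticBasis hτ hgen) I hI
    have hg : good (bI 0) (bI 1) :=
      ⟨(bI 0).2, (bI 1).2, abs_im_conj_mul_eq_absNorm_mul hτ hgen I bI⟩
    obtain ⟨a, b, c, d, -, -, hA, -, hC⟩ := hform _ _ hg
    refine ⟨((b ^ 2 - a * c) + (c ^ 2 - b * d)).toNat, _, _, hg, ?_⟩
    have hnn : 0 ≤ (b ^ 2 - a * c) + (c ^ 2 - b * d) := by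
      have : (0 : ℝ) ≤ Ideal.absNorm I * (((b ^ 2 - a * c) + (c ^ 2 - b * d) : ℤ) : ℝ) := by
        push_cast at hA hC ⊢
        linarith [Complex.normSq_nonneg (φ (bI 0)), Complex.normSq_nonneg (φ (bI 1))]
      exact_mod_cast nonneg_of_mul_nonneg_right this hNpos
    rw [← Int.cast_natCast (R := ℝ) (Int.toNat _), Int.toNat_of_nonneg hnn]
    push_cast at hA hC ⊢
    linarith
  classical
  obtain ⟨α, β, hg, hmin⟩ := Nat.find_spec hex
  have hle : ∀ α' β', good α' β' → Complex.normSq (φ α) + Complex.normSq (φ β) ≤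
      Complex.normSq (φ α') + Complex.normSq (φ β') := by
    intro α' β' h
    obtain ⟨a, b, c, d, -, -, hA, -, hC⟩ := hform _ _ h
    have hnn : 0 ≤ (b ^ 2 - a * c) + (c ^ 2 - b * d) := by
      have : (0 : ℝ) ≤ Ideal.absNorm I * (((b ^ 2 - a * c) + (c ^ 2 - b * d) : ℤ) : ℝ) := by
        push_cast at hA hC ⊢
        linarith [Complex.normSq_nonneg (φ α'), Complex.normSq_nonneg (φ β')]
      exact_mod_cast nonneg_of_mul_nonneg_right this hNpos
    have hval : Complex.normSq (φ α') + Complex.normSq (φ β') =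
        Ideal.absNorm I * (((b ^ 2 - a * c) + (c ^ 2 - b * d)).toNat : ℝ) := by
      rw [← Int.cast_natCast (R := ℝ) (Int.toNat _), Int.toNat_of_nonneg hnn]
      push_cast at hA hC ⊢
      linarith
    rw [hmin, hval]
    have := Nat.find_min' hex ⟨α', β', h, hval⟩
    gcongr
  have hswap : ∀ α β, good α β → good β α := by
    rintro α β ⟨h1, h2, h3⟩
    refine ⟨h2, h1, ?_⟩
    rw [← h3, ← abs_neg]
    congr 1
    simp
    ring
  have hadd : ∀ α β, ∀ s : ℤ, good α β → good α (β + s * α) := by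
    rintro α β s ⟨h1, h2, h3⟩
    refine ⟨h1, I.add_mem h2 (I.mul_mem_left _ h1), ?_⟩
    rw [← h3]
    congr 1
    simp
    ring
  obtain ⟨α, β, hg, hle, hAC⟩ : ∃ α β, good α β ∧ (∀ α' β', good α' β' →
      Complex.normSq (φ α) + Complex.normSq (φ β) ≤
        Complex.normSq (φ α') + Complex.normSq (φ β')) ∧
      Complex.normSq (φ α) ≤ Complex.normSq (φ β) := by
    rcases le_total (Complex.normSq (φ α)) (Complex.normSq (φ β)) with h | h
    · exact ⟨α, β, hg, hle, h⟩
    · exact ⟨β, α, hswap _ _ hg, fun α' β' h' => by linarith [hle α' β' h'], h⟩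
  obtain ⟨a, b, c, d, ha, hd, hA, hB, hC⟩ := hform _ _ hg
  have hexp : ∀ s : ℤ, Complex.normSq (φ (β + s * α)) = Complex.normSq (φ β) +
      s * (2 * ((starRingEnd ℂ) (φ α) * φ β).re) + s ^ 2 * Complex.normSq (φ α) := by
    intro s
    simp [Complex.normSq_apply]
    ring
  refine ⟨a, b, c, d, ha, hd, ?_, ?_, ?_⟩
  · have h1 := hle _ _ (hadd _ _ 1 hg)
    have h2 := hle _ _ (hadd _ _ (-1) hg)
    rw [hexp] at h1 h2
    rw [← hA, ← hB, ← hC] at h1 h2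
    have : |((b * c - a * d : ℤ) : ℝ)| ≤ ((b ^ 2 - a * c : ℤ) : ℝ) := by
      rw [abs_le]
      constructor <;> refine le_of_mul_le_mul_left ?_ hNpos <;> push_cast at * <;> linarith
    exact_mod_cast this
  · rw [← hA, ← hC] at hAC
    exact_mod_cast le_of_mul_le_mul_left hAC hNpos
  · apply mul_left_cancel₀ (pow_ne_zero 2 hNpos.ne')
    have hsq : ((starRingEnd ℂ) (φ α) * φ β).im ^ 2 =
        (Ideal.absNorm I : ℝ) ^ 2 * (φ τ).im ^ 2 := by
      rw [← sq_abs, hg.2.2, mul_pow, sq_abs]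
    have e : (2 * ((starRingEnd ℂ) (φ α) * φ β).re) ^ 2 -
        4 * Complex.normSq (φ α) * Complex.normSq (φ β) =
        -4 * ((starRingEnd ℂ) (φ α) * φ β).im ^ 2 := by
      simp [Complex.normSq_apply]
      ring
    rw [hsq, ← hA, ← hB, ← hC] at e
    push_cast at e ⊢
    linear_combination e

end QuadraticRing

section ImaginaryQuadratic

theorem exists_rat_of_mem_adjoin_sqrt {w : ℂ} {m : ℤ} (hw : w ^ 2 = -(m : ℂ)) {z : ℂ}
    (hz : z ∈ ℚ⟮w⟯) : ∃ r s : ℚ, z = r + s * w := by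
  have halg : IsAlgebraic ℚ w := by
    refine ⟨Polynomial.X ^ 2 + Polynomial.C (m : ℚ), ?_, by simp [hw]⟩
    exact Polynomial.X_pow_add_C_ne_zero two_pos _
  rw [← IntermediateField.mem_toSubalgebra,
    IntermediateField.adjoin_simple_toSubalgebra_of_isAlgebraic halg] at hz
  induction hz using Algebra.adjoin_induction with
  | mem x hx =>
    rw [Set.mem_singleton_iff] at hx
    exact ⟨0, 1, by simp [hx]⟩
  | algebraMap r => exact ⟨r, 0, by simp⟩
  | add x y _ _ hx hy =>
    obtain ⟨r, s, rfl⟩ := hx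
    obtain ⟨r', s', rfl⟩ := hy
    exact ⟨r + r', s + s', by push_cast; ring⟩
  | mul x y _ _ hx hy =>
    obtain ⟨r, s, rfl⟩ := hx
    obtain ⟨r', s', rfl⟩ := hy
    exact ⟨r * r' - m * s * s', r * s' + s * r', by
      push_cast
      linear_combination (s * s' : ℂ) * hw⟩

theorem exists_int_of_squarefree_mul_sq {m : ℤ} (hm : Squarefree m) {q : ℚ} {N : ℤ}
    (h : m * q ^ 2 = N) : ∃ u : ℤ, q = u := by
  have hden : (q.den : ℚ) ≠ 0 := by exact_mod_cast q.den_nz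
  have h1 : m * q.num ^ 2 = N * (q.den : ℤ) ^ 2 := by
    have : (m * q.num ^ 2 : ℚ) = N * (q.den : ℚ) ^ 2 := by
      rw [← h]
      nth_rewrite 2 [← Rat.num_div_den q]
      field_simp
    exact_mod_cast this
  have hcop : IsCoprime ((q.den : ℤ) ^ 2) (q.num ^ 2) := by
    apply IsCoprime.pow
    rw [Int.isCoprime_iff_gcd_eq_one, Int.gcd_comm]
    exact q.reduced
  have hdvd : (q.den : ℤ) ^ 2 ∣ m := hcop.dvd_of_dvd_mul_right ⟨N, by rw [h1]; ring⟩
  have hu : IsUnit (q.den : ℤ) := hm _ (by rwa [← pow_two])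
  have hd1 : q.den = 1 := by simpa using Int.isUnit_iff_natAbs_eq.1 hu
  exact ⟨q.num, (Rat.den_eq_one_iff q).1 hd1 |>.symm⟩

theorem conj_eq_neg_of_sq_eq_neg {w : ℂ} {m : ℤ} (hm : 0 < m) (hw : w ^ 2 = -(m : ℂ)) :
    w.re = 0 ∧ w.im ^ 2 = m := by
  have hre := congrArg Complex.re hw
  have him := congrArg Complex.im hw
  simp [pow_two] at hre him
  have hm' : (0 : ℝ) < m := by exact_mod_cast hm
  have h0 : w.re * w.im = 0 := by linarith
  have hi : w.im ≠ 0 := by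
    intro h
    rw [h] at hre
    nlinarith [mul_self_nonneg w.re]
  have hr : w.re = 0 := by simpa [hi] using h0
  exact ⟨hr, by rw [hr] at hre; linarith⟩

theorem exists_int_of_isIntegral_sqrt {w : ℂ} {m : ℤ} (hm : 0 < m) (hsq : Squarefree m)
    (hw : w ^ 2 = -(m : ℂ)) {z : ℂ} (hz : z ∈ ℚ⟮w⟯) (hint : IsIntegral ℤ z) :
    ∃ t u : ℤ, 2 * z = t + u * w ∧ 4 ∣ t ^ 2 + m * u ^ 2 := by
  obtain ⟨r, s, rfl⟩ := exists_rat_of_mem_adjoin_sqrt hw hz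
  obtain ⟨hre, him⟩ := conj_eq_neg_of_sq_eq_neg hm hw
  have hcw : (starRingEnd ℂ) w = -w := by
    apply Complex.ext <;> simp [hre]
  have hconj : (starRingEnd ℂ) (r + s * w) = r - s * w := by
    simp [hcw, sub_eq_add_neg]
  have hint' : IsIntegral ℤ ((r : ℂ) - s * w) := by
    rw [← hconj]
    exact hint.map (Complex.conjAe.toAlgHom.restrictScalars ℤ)
  have hrat : ∀ q : ℚ, IsIntegral ℤ (q : ℂ) → ∃ k : ℤ, q = k := by
    intro q hq
    have : IsIntegral ℤ q := (isIntegral_algebraMap_iff (algebraMap ℚ ℂ).injective).1 hq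
    obtain ⟨k, hk⟩ := IsIntegrallyClosed.isIntegral_iff.1 this
    exact ⟨k, by simpa using hk.symm⟩
  obtain ⟨t, ht⟩ := hrat (2 * r) (by
    have := hint.add hint'
    have e : ((2 * r : ℚ) : ℂ) = (r + s * w) + (r - s * w) := by
      push_cast
      ring
    rwa [e])
  obtain ⟨N, hN⟩ := hrat (r ^ 2 + m * s ^ 2) (by
    have := hint.mul hint'
    have e : ((r ^ 2 + m * s ^ 2 : ℚ) : ℂ) = (r + s * w) * (r - s * w) := by
      push_cast
      linear_combination (s ^ 2 : ℂ) * hw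
    rwa [e])
  obtain ⟨u, hu⟩ := exists_int_of_squarefree_mul_sq hsq (q := 2 * s) (N := 4 * N - t ^ 2) (by
    push_cast
    rw [← hN, ← ht]
    ring)
  refine ⟨t, u, ?_, N, ?_⟩
  · have ht' : (2 * r : ℂ) = t := by exact_mod_cast congrArg (Rat.cast (K := ℂ)) ht
    have hu' : (2 * s : ℂ) = u := by exact_mod_cast congrArg (Rat.cast (K := ℂ)) hu
    linear_combination ht' + w * hu'
  · have : ((t ^ 2 + m * u ^ 2 : ℤ) : ℚ) = ((4 * N : ℤ) : ℚ) := by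
      push_cast
      rw [← hN, ← ht, ← hu]
      ring
    exact_mod_cast this

/-- If `3` divides the class number of `ℚ(√-m)`, there is a cubic form with reduced Hessian
and discriminant that of `ℚ(√-m)`, with nonzero outer coefficients. -/
theorem exists_reduced_cubic_form_of_three_dvd_classNumber {w : ℂ} {m : ℤ} (hm : 0 < m)
    (hsq : Squarefree m) (hw : w ^ 2 = -(m : ℂ)) {F : IntermediateField ℚ ℂ} (hF : F = ℚ⟮w⟯)
    [NumberField F] (h3 : 3 ∣ NumberField.classNumber F) :
    ∃ a b c d : ℤ, a ≠ 0 ∧ d ≠ 0 ∧ |b * c - a * d| ≤ b ^ 2 - a * c ∧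
      b ^ 2 - a * c ≤ c ^ 2 - b * d ∧
      (b * c - a * d) ^ 2 - 4 * (b ^ 2 - a * c) * (c ^ 2 - b * d) =
        if m % 4 = 3 then -m else -4 * m := by
  obtain ⟨g, hg⟩ := exists_prime_orderOf_dvd_card (G := ClassGroup (NumberField.RingOfIntegers F))
    3 h3
  obtain ⟨⟨I, hI0⟩, rfl⟩ := ClassGroup.mk0_surjective g
  have hI : I ≠ ⊥ := nonZeroDivisors.ne_zero hI0
  have hIp : ¬ I.IsPrincipal := by
    rw [← ClassGroup.mk0_eq_one_iff hI0]
    intro h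
    rw [h, orderOf_one] at hg
    omega
  have hcube : (I ^ 3).IsPrincipal := by
    have h := pow_orderOf_eq_one (ClassGroup.mk0 ⟨I, hI0⟩)
    rw [hg, ← map_pow] at h
    exact (ClassGroup.mk0_eq_one_iff (pow_mem hI0 3)).1 h
  obtain ⟨δ, hδ⟩ := hcube
  rw [Ideal.submodule_span_eq] at hδ
  let φ : NumberField.RingOfIntegers F →+* ℂ :=
    (F.val : F →+* ℂ).comp (algebraMap (NumberField.RingOfIntegers F) F)
  have hφ : Function.Injective φ :=
    (F.val : F →+* ℂ).injective.comp NumberField.RingOfIntegers.coe_injective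
  have hφint : ∀ z, φ z ∈ ℚ⟮w⟯ ∧ IsIntegral ℤ (φ z) := fun z =>
    ⟨hF ▸ (z : F).2, (NumberField.RingOfIntegers.isIntegral_coe z).map
      (F.val.restrictScalars ℤ)⟩
  have hlift : ∀ z : ℂ, z ∈ ℚ⟮w⟯ → IsIntegral ℤ z → ∃ x, φ x = z := by
    intro z hz hint
    refine ⟨⟨⟨z, hF ▸ hz⟩, ?_⟩, rfl⟩
    exact (isIntegral_algHom_iff (F.val.restrictScalars ℤ) Subtype.val_injective).1 hint
  obtain ⟨hre, him⟩ := conj_eq_neg_of_sq_eq_neg hm hw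
  have hm' : (0 : ℝ) < m := by exact_mod_cast hm
  have him0 : w.im ≠ 0 := by
    intro h
    rw [h] at him
    norm_num at him
    linarith
  have hwmem : w ∈ ℚ⟮w⟯ := IntermediateField.mem_adjoin_simple_self ℚ w
  have hm4 : m % 4 ≠ 0 := by
    intro h
    have := hsq 2 (by omega)
    norm_num [Int.isUnit_iff] at this
  by_cases h4 : m % 4 = 3
  · obtain ⟨τ, hτ⟩ := hlift ((1 + w) / 2)
      (div_mem (add_mem (one_mem _) hwmem) (ofNat_mem _ 2)) (by
        refine ⟨Polynomial.X ^ 2 - Polynomial.X + Polynomial.C ((1 + m) / 4), ?_, ?_⟩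
        · monicity!
        · obtain ⟨k, hk⟩ : ∃ k, 1 + m = 4 * k := ⟨(1 + m) / 4, by omega⟩
          have hk' : (1 + m : ℂ) = 4 * k := by exact_mod_cast hk
          rw [hk]
          simp only [Polynomial.eval₂_add, Polynomial.eval₂_sub, Polynomial.eval₂_pow,
            Polynomial.eval₂_X, Polynomial.eval₂_C]
          rw [eq_intCast]
          have hdiv : (4 * k / 4 : ℤ) = k := by omega
          rw [hdiv]
          linear_combination (1 / 4 : ℂ) * hw - (1 / 4 : ℂ) * hk')
    have hτim : (φ τ).im = w.im / 2 := by
      rw [hτ]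
      simp
    obtain ⟨a, b, c, d, ha, hd, h1, h2, h5⟩ := exists_reduced_cubic_form (φ := φ) (τ := τ)
      (by rw [hτim]; simpa using him0) (by
        intro z
        obtain ⟨t, u, htu, hdvd⟩ := exists_int_of_isIntegral_sqrt hm hsq hw (hφint z).1 (hφint z).2
        obtain ⟨k, hk⟩ : ∃ k, t - u = 2 * k := by
          have hpar : (2 : ℤ) ∣ t - u := by
            have h : (4 : ℤ) ∣ t ^ 2 - u ^ 2 := by
              obtain ⟨e, he⟩ := hdvd
              exact ⟨e - (m + 1) / 4 * u ^ 2, by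
                have : m = 4 * ((m + 1) / 4) - 1 := by omega
                linear_combination he - u ^ 2 * this⟩
            have h2 : Even (t ^ 2 - u ^ 2) := even_iff_two_dvd.2 (dvd_trans (by norm_num) h)
            rw [← even_iff_two_dvd]
            simpa [Int.even_sub, Int.even_pow] using h2
          exact hpar
        refine ⟨k, u, hφ ?_⟩
        have hk' : (t - u : ℂ) = 2 * k := by exact_mod_cast hk
        simp only [map_add, map_mul, map_intCast, hτ]
        linear_combination (1 / 2 : ℂ) * htu + (1 / 2 : ℂ) * hk') hφ hI hIp hδ
    refine ⟨a, b, c, d, ha, hd, h1, h2, ?_⟩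
    rw [if_pos h4]
    rw [hτim] at h5
    have : (((b * c - a * d) ^ 2 - 4 * (b ^ 2 - a * c) * (c ^ 2 - b * d) : ℤ) : ℝ) =
        ((-m : ℤ) : ℝ) := by
      rw [h5]
      push_cast
      linear_combination -him
    exact_mod_cast this
  · obtain ⟨τ, hτ⟩ := hlift w hwmem (by
        refine ⟨Polynomial.X ^ 2 + Polynomial.C m, ?_, ?_⟩
        · monicity!
        · simp only [Polynomial.eval₂_add, Polynomial.eval₂_pow, Polynomial.eval₂_X,
            Polynomial.eval₂_C, hw]
          rw [eq_intCast, neg_add_cancel])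
    obtain ⟨a, b, c, d, ha, hd, h1, h2, h5⟩ := exists_reduced_cubic_form (φ := φ) (τ := τ)
      (by rw [hτ]; exact him0) (by
        intro z
        obtain ⟨t, u, htu, hdvd⟩ := exists_int_of_isIntegral_sqrt hm hsq hw (hφint z).1 (hφint z).2
        have hpar : 2 ∣ t ∧ 2 ∣ u := by
          have h1 : (t ^ 2 + m * u ^ 2) % 4 = 0 := Int.emod_eq_zero_of_dvd hdvd
          have h6 : (t % 4) = 0 ∨ t % 4 = 1 ∨ t % 4 = 2 ∨ t % 4 = 3 := by omega
          have h7 : (u % 4) = 0 ∨ u % 4 = 1 ∨ u % 4 = 2 ∨ u % 4 = 3 := by omega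
          have h8 : m % 4 = 1 ∨ m % 4 = 2 := by omega
          rcases h6 with h6 | h6 | h6 | h6 <;> rcases h7 with h7 | h7 | h7 | h7 <;>
            rcases h8 with h8 | h8 <;>
            simp [pow_two, Int.add_emod, Int.mul_emod, h6, h7, h8] at h1 <;> omega
        obtain ⟨⟨k, rfl⟩, ⟨l, rfl⟩⟩ := hpar
        refine ⟨k, l, hφ ?_⟩
        simp only [map_add, map_mul, map_intCast, hτ]
        push_cast at htu
        linear_combination (1 / 2 : ℂ) * htu) hφ hI hIp hδ
    refine ⟨a, b, c, d, ha, hd, h1, h2, ?_⟩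
    rw [if_neg h4]
    rw [hτ] at h5
    have : (((b * c - a * d) ^ 2 - 4 * (b ^ 2 - a * c) * (c ^ 2 - b * d) : ℤ) : ℝ) =
        ((-4 * m : ℤ) : ℝ) := by
      rw [h5]
      push_cast
      linear_combination -4 * him
    exact_mod_cast this

end ImaginaryQuadratic

section Volume
open MeasureTheory Set

/-- The leading coefficient of the Hessian of the cubic form with first two coefficients `a, b`
whose Hessian is proportional to `x² - p x y + q y²`. -/
def hessianLead (x y : ℝ × ℝ) : ℝ := x.2 ^ 2 + y.1 * x.1 * x.2 + y.2 * x.1 ^ 2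

/-- The last two coefficients of the cubic form with first two coefficients `x` whose Hessian is
proportional to `X² - p X Y + q Y²` with `(p, q) = y`. -/
def cubicTail (x y : ℝ × ℝ) : ℝ × ℝ :=
  (-y.1 * x.2 - y.2 * x.1, y.1 ^ 2 * x.2 + y.1 * y.2 * x.1 - y.2 * x.2)

/-- The derivative of `cubicTail x`. -/
noncomputable def cubicTailDeriv (x y : ℝ × ℝ) : ℝ × ℝ →L[ℝ] ℝ × ℝ :=
  (Matrix.toLin (.finTwoProd ℝ) (.finTwoProd ℝ)
    !![-x.2, -x.1; 2 * y.1 * x.2 + y.2 * x.1, y.1 * x.1 - x.2]).toContinuousLinearMap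

theorem hasFDerivAt_cubicTail (x y : ℝ × ℝ) :
    HasFDerivAt (cubicTail x) (cubicTailDeriv x y) y := by
  unfold cubicTailDeriv
  rw [Matrix.toLin_finTwoProd_toContinuousLinearMap]
  have h1 : HasFDerivAt (fun y : ℝ × ℝ => y.1) (ContinuousLinearMap.fst ℝ ℝ ℝ) y := hasFDerivAt_fst
  have h2 : HasFDerivAt (fun y : ℝ × ℝ => y.2) (ContinuousLinearMap.snd ℝ ℝ ℝ) y := hasFDerivAt_snd
  refine HasFDerivAt.prodMk ?_ ?_
  · refine ((h1.neg.mul_const x.2).sub (h2.mul_const x.1)).congr_fderiv ?_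
    ext <;> simp
  · refine ((((h1.pow 2).mul_const x.2).add ((h1.mul h2).mul_const x.1)).sub
      (h2.mul_const x.2)).congr_fderiv ?_
    ext <;> simp <;> ring

theorem det_cubicTailDeriv (x y : ℝ × ℝ) : (cubicTailDeriv x y).det = hessianLead x y := by
  unfold cubicTailDeriv hessianLead
  simp only [LinearMap.det_toContinuousLinearMap, LinearMap.det_toLin, Matrix.det_fin_two_of]
  ring

/-- Parameters of reduced real cubic forms with bounded discriminant and leading coefficient
bounded away from zero. -/
def reducedParams (η : ℝ) : Set ((ℝ × ℝ) × (ℝ × ℝ)) :=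
  {z | η ≤ |z.1.1| ∧ |z.2.1| ≤ 1 ∧ 1 ≤ z.2.2 ∧
    hessianLead z.1 z.2 ^ 2 * (4 * z.2.2 - z.2.1 ^ 2) ≤ 1}

/-- Reduced real cubic forms with bounded discriminant and leading coefficient
bounded away from zero. -/
def reducedForms (η : ℝ) : Set ((ℝ × ℝ) × (ℝ × ℝ)) :=
  (fun z => (z.1, cubicTail z.1 z.2)) '' reducedParams η

theorem hessianLead_eq (x y : ℝ × ℝ) :
    hessianLead x y = (x.2 + y.1 * x.1 / 2) ^ 2 + (y.2 - y.1 ^ 2 / 4) * x.1 ^ 2 := by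
  unfold hessianLead
  ring

theorem isClosed_reducedParams (η : ℝ) : IsClosed (reducedParams η) := by
  have h1 : IsClosed {z : (ℝ × ℝ) × (ℝ × ℝ) | η ≤ |z.1.1|} :=
    isClosed_le (by fun_prop) (by fun_prop)
  have h2 : IsClosed {z : (ℝ × ℝ) × (ℝ × ℝ) | |z.2.1| ≤ 1} :=
    isClosed_le (by fun_prop) (by fun_prop)
  have h3 : IsClosed {z : (ℝ × ℝ) × (ℝ × ℝ) | 1 ≤ z.2.2} :=
    isClosed_le (by fun_prop) (by fun_prop)
  have h4 : IsClosed {z : (ℝ × ℝ) × (ℝ × ℝ) |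
      hessianLead z.1 z.2 ^ 2 * (4 * z.2.2 - z.2.1 ^ 2) ≤ 1} := by
    unfold hessianLead
    exact isClosed_le (by fun_prop) (by fun_prop)
  exact h1.inter (h2.inter (h3.inter h4))

theorem isCompact_reducedParams {η : ℝ} (hη : 0 < η) : IsCompact (reducedParams η) := by
  have hsub : reducedParams η ⊆
      (Icc (-2) 2 ×ˢ Icc (-2) 2) ×ˢ (Icc (-1) 1 ×ˢ Icc 0 (4 / η ^ 2)) := by
    rintro ⟨⟨a, b⟩, ⟨p, q⟩⟩ ⟨h1, h2, h3, h4⟩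
    simp only at h1 h2 h3 h4
    rw [hessianLead_eq] at h4
    simp only at h4
    have hp : p ^ 2 ≤ 1 := by rw [← sq_abs]; nlinarith [abs_nonneg p]
    set Q := (b + p * a / 2) ^ 2 + (q - p ^ 2 / 4) * a ^ 2 with hQ
    have hQ0 : 0 ≤ Q := by
      have : 0 ≤ q - p ^ 2 / 4 := by linarith
      positivity
    have hQ1 : Q ≤ 1 := by
      by_contra! h
      nlinarith
    have ha2 : η ^ 2 ≤ a ^ 2 := by
      rw [← sq_abs a]
      gcongr
    have hqa : 3 / 4 * q * a ^ 2 ≤ 1 := by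
      have : 3 / 4 * q * a ^ 2 ≤ (q - p ^ 2 / 4) * a ^ 2 := by gcongr; linarith
      nlinarith [sq_nonneg (b + p * a / 2)]
    have ha : |a| ≤ 2 := by
      apply abs_le_of_sq_le_sq _ (by norm_num)
      nlinarith [sq_nonneg a]
    have hb' : |b + p * a / 2| ≤ 1 := by
      apply abs_le_of_sq_le_sq _ (by norm_num)
      have : 0 ≤ (q - p ^ 2 / 4) * a ^ 2 := mul_nonneg (by linarith) (sq_nonneg _)
      linarith
    have hpa : |p * a / 2| ≤ 1 := by
      rw [abs_div, abs_mul, abs_two]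
      nlinarith [abs_nonneg p, abs_nonneg a]
    rw [abs_le] at ha hb' hpa h2
    refine ⟨⟨⟨ha.1, ha.2⟩, ⟨by simp only; linarith, by simp only; linarith⟩⟩,
      ⟨⟨h2.1, h2.2⟩, ⟨by simp only; linarith, ?_⟩⟩⟩
    simp only
    rw [le_div_iff₀ (by positivity)]
    nlinarith
  exact ((isCompact_Icc.prod isCompact_Icc).prod
    (isCompact_Icc.prod isCompact_Icc)).of_isClosed_subset
    (isClosed_reducedParams η) hsub

theorem isCompact_reducedForms {η : ℝ} (hη : 0 < η) : IsCompact (reducedForms η) := by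
  apply (isCompact_reducedParams hη).image
  unfold cubicTail
  fun_prop

theorem lintegral_comp_shear {v p : ℝ} (hv : 0 < v) (G : ℝ × ℝ → ENNReal) (hG : Measurable G) :
    ∫⁻ y, G y = ENNReal.ofReal v * ∫⁻ x : ℝ × ℝ, G (x.1, v * x.2 - p * x.1 / 2) := by
  set L : ℝ × ℝ →ₗ[ℝ] ℝ × ℝ := Matrix.toLin (.finTwoProd ℝ) (.finTwoProd ℝ) !![1, 0; -p / 2, v]
    with hL
  have hdet : LinearMap.det L = v := by
    rw [hL, LinearMap.det_toLin, Matrix.det_fin_two_of]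
    ring
  have hLx : ∀ x : ℝ × ℝ, L x = (x.1, v * x.2 - p * x.1 / 2) := by
    intro x
    rw [hL, Matrix.toLin_finTwoProd_apply]
    ext <;> simp
    ring
  have hmap := Measure.map_linearMap_addHaar_eq_smul_addHaar (volume : Measure (ℝ × ℝ))
    (f := L) (by rw [hdet]; exact hv.ne')
  have hmeas : Measurable L := L.continuous_of_finiteDimensional.measurable
  have h1 : ∫⁻ x : ℝ × ℝ, G (x.1, v * x.2 - p * x.1 / 2) = ENNReal.ofReal v⁻¹ * ∫⁻ y, G y := by
    simp_rw [← hLx]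
    rw [← lintegral_map hG hmeas, hmap, lintegral_smul_measure, hdet,
      abs_of_pos (inv_pos.2 hv), smul_eq_mul]
  rw [h1, ← mul_assoc, ← ENNReal.ofReal_mul hv.le, mul_inv_cancel₀ hv.ne', ENNReal.ofReal_one,
    one_mul]

theorem lintegral_disc_cube {v : ℝ} (hv : 0 < v) :
    ∫⁻ x : ℝ × ℝ, indicator {x : ℝ × ℝ | 4 * v ^ 6 * (x.1 ^ 2 + x.2 ^ 2) ^ 2 ≤ 1}
      (fun x => ENNReal.ofReal (v ^ 2 * (x.1 ^ 2 + x.2 ^ 2))) x ≤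
    ENNReal.ofReal (π / (8 * v ^ 4)) := by
  rw [← lintegral_comp_polarCoord_symm]
  set r₀ := Real.sqrt (1 / (2 * v ^ 3)) with hr₀
  have hr₀4 : r₀ ^ 4 = 1 / (4 * v ^ 6) := by
    have : r₀ ^ 4 = (r₀ ^ 2) ^ 2 := by ring
    rw [this, hr₀, Real.sq_sqrt (by positivity)]
    field_simp
    norm_num
  have hr₀0 : 0 ≤ r₀ := Real.sqrt_nonneg _
  calc _ ≤ ∫⁻ x : ℝ × ℝ in polarCoord.target,
        indicator (Icc 0 r₀) (fun r => ENNReal.ofReal (v ^ 2 * r ^ 3)) x.1 * 1 := by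
        refine setLIntegral_mono' polarCoord.open_target.measurableSet ?_
        rintro ⟨r, θ⟩ hx
        have hr : 0 < r := hx.1
        have hsum : (r * Real.cos θ) ^ 2 + (r * Real.sin θ) ^ 2 = r ^ 2 := by
          linear_combination r ^ 2 * Real.cos_sq_add_sin_sq θ
        simp only [polarCoord_symm_apply, mul_one, smul_eq_mul]
        by_cases h : 4 * v ^ 6 * (r ^ 2) ^ 2 ≤ 1
        · rw [indicator_of_mem (by simpa [hsum] using h), indicator_of_mem]
          · rw [hsum, ← ENNReal.ofReal_mul hr.le]
            apply ENNReal.ofReal_le_ofReal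
            apply le_of_eq
            ring
          · refine ⟨hr.le, ?_⟩
            apply le_of_pow_le_pow_left₀ (n := 4) (by norm_num) hr₀0
            rw [hr₀4, le_div_iff₀ (by positivity)]
            linarith
        · rw [indicator_of_notMem (by simpa [hsum] using h), mul_zero]
          exact zero_le
    _ = (∫⁻ r in Ioi 0, indicator (Icc 0 r₀) (fun r => ENNReal.ofReal (v ^ 2 * r ^ 3)) r) *
          ∫⁻ θ in Ioo (-π) π, 1 := by
        rw [polarCoord_target, Measure.volume_eq_prod, ← Measure.prod_restrict]
        rw [lintegral_prod_mul (f := indicator (Icc 0 r₀) (fun r => ENNReal.ofReal (v ^ 2 * r ^ 3)))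
          (g := fun _ => 1)]
        · exact (Measurable.indicator (by fun_prop) measurableSet_Icc).aemeasurable
        · fun_prop
    _ ≤ (∫⁻ r in Icc 0 r₀, ENNReal.ofReal (v ^ 2 * r ^ 3)) * ENNReal.ofReal (2 * π) := by
        refine mul_le_mul' ?_ ?_
        · rw [← lintegral_indicator measurableSet_Icc]
          exact setLIntegral_le_lintegral _ _
        · rw [setLIntegral_one, Real.volume_Ioo]
          apply le_of_eq
          congr 1
          ring
    _ = ENNReal.ofReal (v ^ 2 * r₀ ^ 4 / 4) * ENNReal.ofReal (2 * π) := by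
        congr 1
        rw [← ofReal_integral_eq_lintegral_ofReal]
        · rw [integral_Icc_eq_integral_Ioc, ← intervalIntegral.integral_of_le hr₀0]
          simp
          congr 1
          ring
        · exact (by fun_prop : Continuous fun r : ℝ => v ^ 2 * r ^ 3).integrableOn_Icc
        · refine (ae_restrict_iff' measurableSet_Icc).2 (Filter.Eventually.of_forall ?_)
          intro r hr
          have := hr.1
          positivity
    _ = ENNReal.ofReal (π / (8 * v ^ 4)) := by
        rw [← ENNReal.ofReal_mul (by positivity), hr₀4]
        congr 1
        field_simp
        norm_num

theorem measurable_hessianLead : Measurable (fun z : (ℝ × ℝ) × (ℝ × ℝ) => hessianLead z.1 z.2) := by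
  unfold hessianLead
  fun_prop

theorem lintegral_hessianLead_le {y : ℝ × ℝ} (hp : |y.1| ≤ 1) (hq : 1 ≤ y.2) :
    ∫⁻ x : ℝ × ℝ, indicator {x : ℝ × ℝ | hessianLead x y ^ 2 * (4 * y.2 - y.1 ^ 2) ≤ 1}
      (fun x => ENNReal.ofReal |hessianLead x y|) x ≤
    ENNReal.ofReal (π / 8 * (y.2 - y.1 ^ 2 / 4) ^ (-(3 / 2) : ℝ)) := by
  have hp2 : y.1 ^ 2 ≤ 1 := by rw [← sq_abs]; nlinarith [abs_nonneg y.1]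
  have hpos : 0 < y.2 - y.1 ^ 2 / 4 := by linarith
  set v := Real.sqrt (y.2 - y.1 ^ 2 / 4) with hv
  have hv0 : 0 < v := Real.sqrt_pos.2 hpos
  have hv2 : v ^ 2 = y.2 - y.1 ^ 2 / 4 := Real.sq_sqrt hpos.le
  have hmeas : Measurable (fun x => hessianLead x y) := by
    unfold hessianLead
    fun_prop
  rw [lintegral_comp_shear (p := y.1) hv0]
  swap
  · exact Measurable.indicator (by fun_prop) (measurableSet_le (by fun_prop) measurable_const)
  have hval : ∀ x : ℝ × ℝ, hessianLead (x.1, v * x.2 - y.1 * x.1 / 2) y =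
      v ^ 2 * (x.1 ^ 2 + x.2 ^ 2) := by
    intro x
    rw [hessianLead_eq, ← hv2]
    ring
  calc _ ≤ ENNReal.ofReal v * ENNReal.ofReal (π / (8 * v ^ 4)) := by
        gcongr
        refine le_trans (lintegral_mono fun x => ?_) (lintegral_disc_cube hv0)
        apply le_of_eq
        have hiff : (x.1, v * x.2 - y.1 * x.1 / 2) ∈
            {x : ℝ × ℝ | hessianLead x y ^ 2 * (4 * y.2 - y.1 ^ 2) ≤ 1} ↔
            x ∈ {x : ℝ × ℝ | 4 * v ^ 6 * (x.1 ^ 2 + x.2 ^ 2) ^ 2 ≤ 1} := by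
          simp only [mem_ofPred_eq, hval]
          have : (v ^ 2 * (x.1 ^ 2 + x.2 ^ 2)) ^ 2 * (4 * y.2 - y.1 ^ 2) =
              4 * v ^ 6 * (x.1 ^ 2 + x.2 ^ 2) ^ 2 := by
            have : 4 * y.2 - y.1 ^ 2 = 4 * v ^ 2 := by rw [hv2]; ring
            rw [this]
            ring
          rw [this]
        by_cases h : x ∈ {x : ℝ × ℝ | 4 * v ^ 6 * (x.1 ^ 2 + x.2 ^ 2) ^ 2 ≤ 1}
        · rw [indicator_of_mem h, indicator_of_mem (hiff.2 h), hval, abs_of_nonneg (by positivity)]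
        · rw [indicator_of_notMem h, indicator_of_notMem (fun h' => h (hiff.1 h'))]
    _ = _ := by
        rw [← ENNReal.ofReal_mul hv0.le]
        congr 1
        have : (y.2 - y.1 ^ 2 / 4) ^ (-(3 / 2) : ℝ) = (v ^ 3)⁻¹ := by
          rw [Real.rpow_neg hpos.le, hv, Real.sqrt_eq_rpow, ← Real.rpow_mul_natCast hpos.le]
          norm_num
        rw [this]
        field_simp

theorem lintegral_Ici_rpow_le {p : ℝ} (hp : |p| ≤ 1) :
    ∫⁻ q in Ici 1, ENNReal.ofReal (π / 8 * (q - p ^ 2 / 4) ^ (-(3 / 2) : ℝ)) ≤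
      ENNReal.ofReal (π / 4 * (1 - p ^ 2 / 4) ^ (-(1 / 2) : ℝ)) := by
  have hp2 : p ^ 2 ≤ 1 := by rw [← sq_abs]; nlinarith [abs_nonneg p]
  rw [setLIntegral_congr Ioi_ae_eq_Ici.symm]
  have hderiv : ∀ q ∈ Ici (1 : ℝ), HasDerivAt
      (fun q => -(π / 4) * (q - p ^ 2 / 4) ^ (-(1 / 2) : ℝ))
      (π / 8 * (q - p ^ 2 / 4) ^ (-(3 / 2) : ℝ)) q := by
    intro q hq
    have hq1 : (1 : ℝ) ≤ q := hq
    have hpos : 0 < q - p ^ 2 / 4 := by linarith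
    have := (((hasDerivAt_id q).sub_const (p ^ 2 / 4)).rpow_const (p := -(1 / 2))
      (Or.inl hpos.ne')).const_mul (-(π / 4))
    refine this.congr_deriv ?_
    simp only [id]
    norm_num
    ring
  have hpos : ∀ q ∈ Ioi (1 : ℝ), 0 ≤ π / 8 * (q - p ^ 2 / 4) ^ (-(3 / 2) : ℝ) := by
    intro q hq
    have hq1 : (1 : ℝ) < q := hq
    have : 0 < q - p ^ 2 / 4 := by linarith
    positivity
  have htend : Filter.Tendsto (fun q => -(π / 4) * (q - p ^ 2 / 4) ^ (-(1 / 2) : ℝ))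
      Filter.atTop (nhds (-(π / 4) * 0)) := by
    apply Filter.Tendsto.const_mul
    exact (tendsto_rpow_neg_atTop (by norm_num)).comp
      (Filter.tendsto_atTop_add_const_right _ (-(p ^ 2 / 4)) Filter.tendsto_id)
  rw [← ofReal_integral_eq_lintegral_ofReal
    (integrableOn_Ioi_deriv_of_nonneg' hderiv hpos htend)
    ((ae_restrict_iff' measurableSet_Ioi).2 (Filter.Eventually.of_forall hpos)),
    integral_Ioi_of_hasDerivAt_of_nonneg' hderiv hpos htend]
  apply ENNReal.ofReal_le_ofReal
  apply le_of_eq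
  ring

theorem lintegral_Icc_rpow_le :
    ∫⁻ p in Icc (-1 : ℝ) 1, ENNReal.ofReal (π / 4 * (1 - p ^ 2 / 4) ^ (-(1 / 2) : ℝ)) ≤
      ENNReal.ofReal (π ^ 2 / 6) := by
  have hpos : ∀ p ∈ Icc (-1 : ℝ) 1, 0 < 1 - p ^ 2 / 4 := by
    intro p hp
    nlinarith [hp.1, hp.2]
  have hcont : ContinuousOn (fun p : ℝ => π / 4 * (1 - p ^ 2 / 4) ^ (-(1 / 2) : ℝ))
      (Icc (-1) 1) := by
    apply ContinuousOn.mul continuousOn_const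
    apply ContinuousOn.rpow_const (by fun_prop)
    intro p hp
    exact Or.inl (hpos p hp).ne'
  rw [← ofReal_integral_eq_lintegral_ofReal hcont.integrableOn_Icc
    ((ae_restrict_iff' measurableSet_Icc).2 (Filter.Eventually.of_forall fun p hp => by
      have := hpos p hp
      positivity))]
  apply ENNReal.ofReal_le_ofReal
  rw [integral_Icc_eq_integral_Ioc, ← intervalIntegral.integral_of_le (by norm_num)]
  have hI : uIcc (-1 : ℝ) 1 = Icc (-1) 1 := uIcc_of_le (by norm_num)
  rw [intervalIntegral.integral_eq_sub_of_hasDerivAt (f := fun p => π / 2 * Real.arcsin (p / 2))]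
  · have h1 : Real.arcsin (1 / 2) = π / 6 := by
      rw [← Real.sin_pi_div_six]
      exact Real.arcsin_sin (by linarith [Real.pi_pos]) (by linarith [Real.pi_pos])
    have h2 : Real.arcsin (-1 / 2) = -(π / 6) := by
      rw [neg_div, Real.arcsin_neg, h1]
    rw [h1, h2]
    apply le_of_eq
    ring
  · intro p hp
    rw [hI] at hp
    have h0 := hpos p hp
    have hd := ((Real.hasDerivAt_arcsin (x := p / 2) (by linarith [hp.1])
      (by linarith [hp.2])).comp p
      ((hasDerivAt_id p).div_const 2)).const_mul (π / 2)
    refine hd.congr_deriv ?_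
    rw [Real.rpow_neg h0.le, ← Real.sqrt_eq_rpow]
    have : 1 - (p / 2) ^ 2 = 1 - p ^ 2 / 4 := by ring
    rw [this]
    ring
  · exact (hI ▸ hcont).intervalIntegrable

theorem volume_reducedForms_le {η : ℝ} (hη : 0 < η) :
    volume (reducedForms η) ≤ ENNReal.ofReal (π ^ 2 / 6) := by
  have hmeas : MeasurableSet (reducedForms η) := (isCompact_reducedForms hη).isClosed.measurableSet
  have hKmeas : MeasurableSet (reducedParams η) := (isClosed_reducedParams η).measurableSet
  set S : Set ((ℝ × ℝ) × (ℝ × ℝ)) := {z | |z.2.1| ≤ 1 ∧ 1 ≤ z.2.2 ∧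
    hessianLead z.1 z.2 ^ 2 * (4 * z.2.2 - z.2.1 ^ 2) ≤ 1} with hS
  have hSmeas : MeasurableSet S := by
    have h2 : MeasurableSet {z : (ℝ × ℝ) × (ℝ × ℝ) | |z.2.1| ≤ 1} :=
      measurableSet_le (by fun_prop) (by fun_prop)
    have h3 : MeasurableSet {z : (ℝ × ℝ) × (ℝ × ℝ) | 1 ≤ z.2.2} :=
      measurableSet_le (by fun_prop) (by fun_prop)
    have h4 : MeasurableSet {z : (ℝ × ℝ) × (ℝ × ℝ) |
        hessianLead z.1 z.2 ^ 2 * (4 * z.2.2 - z.2.1 ^ 2) ≤ 1} :=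
      measurableSet_le ((measurable_hessianLead.pow_const 2).mul (by fun_prop)) (by fun_prop)
    exact h2.inter (h3.inter h4)
  set F : ((ℝ × ℝ) × (ℝ × ℝ)) → ENNReal :=
    S.indicator fun z => ENNReal.ofReal |hessianLead z.1 z.2| with hF
  have hFmeas : Measurable F :=
    Measurable.indicator (measurable_hessianLead.abs.ennreal_ofReal) hSmeas
  rw [Measure.volume_eq_prod, Measure.prod_apply hmeas]
  calc _ ≤ ∫⁻ x : ℝ × ℝ, ∫⁻ y : ℝ × ℝ, F (x, y) := by
        refine lintegral_mono fun x => ?_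
        have hslice : Prod.mk x ⁻¹' reducedForms η =
            cubicTail x '' (Prod.mk x ⁻¹' reducedParams η) := by
          ext w
          constructor
          · rintro ⟨⟨x', y⟩, hz, he⟩
            simp only [Prod.mk.injEq] at he
            obtain ⟨rfl, rfl⟩ := he
            exact ⟨y, hz, rfl⟩
          · rintro ⟨y, hy, rfl⟩
            exact ⟨(x, y), hy, rfl⟩
        have hKx : MeasurableSet (Prod.mk x ⁻¹' reducedParams η) := measurable_prodMk_left hKmeas
        rw [hslice]
        refine le_trans (addHaar_image_le_lintegral_abs_det_fderiv volume hKx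
          (fun y _ => (hasFDerivAt_cubicTail x y).hasFDerivWithinAt)) ?_
        rw [← lintegral_indicator hKx]
        refine lintegral_mono fun y => ?_
        by_cases hy : y ∈ Prod.mk x ⁻¹' reducedParams η
        · have hyS : (x, y) ∈ S := ⟨hy.2.1, hy.2.2.1, hy.2.2.2⟩
          rw [indicator_of_mem hy, hF, indicator_of_mem hyS, det_cubicTailDeriv]
        · rw [indicator_of_notMem hy]
          exact zero_le
    _ = ∫⁻ y : ℝ × ℝ, ∫⁻ x : ℝ × ℝ, F (x, y) :=
        lintegral_lintegral_swap hFmeas.aemeasurable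
    _ ≤ ∫⁻ y : ℝ × ℝ in Icc (-1) 1 ×ˢ Ici 1,
          ENNReal.ofReal (π / 8 * (y.2 - y.1 ^ 2 / 4) ^ (-(3 / 2) : ℝ)) := by
        rw [← lintegral_indicator (measurableSet_Icc.prod measurableSet_Ici)]
        refine lintegral_mono fun y => ?_
        by_cases hy : y ∈ Icc (-1 : ℝ) 1 ×ˢ Ici (1 : ℝ)
        · rw [indicator_of_mem hy]
          have h1 : |y.1| ≤ 1 := abs_le.2 ⟨hy.1.1, hy.1.2⟩
          refine le_trans (lintegral_mono fun x => ?_) (lintegral_hessianLead_le h1 hy.2)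
          by_cases hx : (x, y) ∈ S
          · rw [hF, indicator_of_mem hx, indicator_of_mem (by exact hx.2.2)]
          · rw [hF, indicator_of_notMem hx]
            exact zero_le
        · rw [indicator_of_notMem hy]
          refine le_of_eq (lintegral_eq_zero_of_ae_eq_zero
            (Filter.Eventually.of_forall fun x => ?_))
          rw [hF]
          refine indicator_of_notMem (fun hx => hy ⟨abs_le.1 hx.1, hx.2.1⟩) _
    _ = ∫⁻ p in Icc (-1 : ℝ) 1, ∫⁻ q in Ici (1 : ℝ),
          ENNReal.ofReal (π / 8 * (q - p ^ 2 / 4) ^ (-(3 / 2) : ℝ)) := by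
        rw [Measure.volume_eq_prod, ← Measure.prod_restrict, lintegral_prod]
        exact (Measurable.ennreal_ofReal (by fun_prop)).aemeasurable
    _ ≤ ∫⁻ p in Icc (-1 : ℝ) 1, ENNReal.ofReal (π / 4 * (1 - p ^ 2 / 4) ^ (-(1 / 2) : ℝ)) := by
        refine setLIntegral_mono' measurableSet_Icc fun p hp => ?_
        exact lintegral_Ici_rpow_le (abs_le.2 hp)
    _ ≤ _ := lintegral_Icc_rpow_le

end Volume

section LatticePoints
open MeasureTheory Set

/-- The real point attached to an integral one. -/
def formCast (v : (ℤ × ℤ) × (ℤ × ℤ)) : (ℝ × ℝ) × (ℝ × ℝ) := ((v.1.1, v.1.2), (v.2.1, v.2.2))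

/-- Reduction modulo `M` of the coefficients. -/
def formMod (M : ℕ) (v : (ℤ × ℤ) × (ℤ × ℤ)) : (ZMod M × ZMod M) × (ZMod M × ZMod M) :=
  ((v.1.1, v.1.2), (v.2.1, v.2.2))

/-- A half-open cube of side `s` with a given corner. -/
def cornerCube (s : ℝ) (z : (ℝ × ℝ) × (ℝ × ℝ)) : Set ((ℝ × ℝ) × (ℝ × ℝ)) :=
  (Ico z.1.1 (z.1.1 + s) ×ˢ Ico z.1.2 (z.1.2 + s)) ×ˢ
    (Ico z.2.1 (z.2.1 + s) ×ˢ Ico z.2.2 (z.2.2 + s))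

theorem volume_cornerCube {s : ℝ} (hs : 0 ≤ s) (z : (ℝ × ℝ) × (ℝ × ℝ)) :
    volume (cornerCube s z) = ENNReal.ofReal (s ^ 4) := by
  unfold cornerCube
  rw [Measure.volume_eq_prod, Measure.prod_prod, Measure.volume_eq_prod, Measure.prod_prod,
    Measure.prod_prod]
  simp only [Real.volume_Ico, add_sub_cancel_left]
  rw [← ENNReal.ofReal_mul hs, ← ENNReal.ofReal_mul (by positivity)]
  congr 1
  ring

theorem measurableSet_cornerCube (s : ℝ) (z : (ℝ × ℝ) × (ℝ × ℝ)) :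
    MeasurableSet (cornerCube s z) :=
  (measurableSet_Ico.prod measurableSet_Ico).prod (measurableSet_Ico.prod measurableSet_Ico)

theorem eq_of_intCast_eq_of_mem_Ico {M : ℕ} {T t : ℝ} (hT : 0 < T) {m n : ℤ}
    (h : (m : ZMod M) = n) (hm : t ∈ Ico (T⁻¹ * m) (T⁻¹ * m + M / T))
    (hn : t ∈ Ico (T⁻¹ * n) (T⁻¹ * n + M / T)) : m = n := by
  have key : ∀ k l : ℤ, t ∈ Ico (T⁻¹ * k) (T⁻¹ * k + M / T) →
      t ∈ Ico (T⁻¹ * l) (T⁻¹ * l + M / T) → l - k < M := by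
    intro k l hk hl
    have h1 : T⁻¹ * l < T⁻¹ * k + M / T := lt_of_le_of_lt hl.1 hk.2
    have h2 : T⁻¹ * k + M / T = T⁻¹ * (k + M) := by ring
    rw [h2] at h1
    have h3 : (l : ℝ) < k + M := lt_of_mul_lt_mul_left h1 (by positivity)
    have h4 : l < k + M := by exact_mod_cast h3
    linarith
  have hd : (M : ℤ) ∣ n - m := (ZMod.intCast_eq_intCast_iff_dvd_sub _ _ _).1 h
  have h0 : n - m = 0 := by
    apply Int.eq_zero_of_abs_lt_dvd hd
    rw [abs_lt]
    have := key m n hm hn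
    have := key n m hn hm
    constructor <;> linarith
  linarith

theorem card_mul_pow_le_of_isCompact {R : Set ((ℝ × ℝ) × (ℝ × ℝ))} (hR : IsCompact R) {M : ℕ}
    (hM : 0 < M) {η : ℝ} (hη : 0 < η) :
    ∀ᶠ T : ℝ in Filter.atTop, ∀ r, ∀ F : Finset ((ℤ × ℤ) × (ℤ × ℤ)),
      (∀ v ∈ F, formMod M v = r ∧ T⁻¹ • formCast v ∈ R) →
        (F.card : ℝ) * M ^ 4 ≤ ((volume R).toReal + η) * T ^ 4 := by
  have hMr : (0 : ℝ) < M := by exact_mod_cast hM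
  have hlim : Filter.Tendsto (fun T : ℝ => volume (Metric.cthickening (M / T) R)) Filter.atTop
      (nhds (volume R)) :=
    (tendsto_measure_cthickening_of_isCompact hR).comp
      (tendsto_const_nhds.div_atTop Filter.tendsto_id)
  have hlt : volume R < ENNReal.ofReal ((volume R).toReal + η) := by
    conv_lhs => rw [← ENNReal.ofReal_toReal hR.measure_lt_top.ne]
    exact (ENNReal.ofReal_lt_ofReal_iff (by positivity)).2 (by linarith)
  filter_upwards [hlim.eventually (gt_mem_nhds hlt), Filter.eventually_gt_atTop (0 : ℝ)]
    with T hT hT0 r F hF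
  have hdisj : (F : Set ((ℤ × ℤ) × (ℤ × ℤ))).PairwiseDisjoint
      (fun v => cornerCube (M / T) (T⁻¹ • formCast v)) := by
    intro v hv w hw hvw
    refine Set.disjoint_left.2 fun z hz hz' => hvw ?_
    have hmod : formMod M v = formMod M w := (hF v hv).1.trans (hF w hw).1.symm
    simp only [formMod, Prod.mk.injEq] at hmod
    obtain ⟨⟨e1, e2⟩, e3, e4⟩ := hmod
    obtain ⟨⟨h1, h2⟩, h3, h4⟩ := hz
    obtain ⟨⟨h1', h2'⟩, h3', h4'⟩ := hz'
    exact Prod.ext (Prod.ext (eq_of_intCast_eq_of_mem_Ico hT0 e1 h1 h1')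
      (eq_of_intCast_eq_of_mem_Ico hT0 e2 h2 h2'))
      (Prod.ext (eq_of_intCast_eq_of_mem_Ico hT0 e3 h3 h3')
      (eq_of_intCast_eq_of_mem_Ico hT0 e4 h4 h4'))
  have hsub : (⋃ v ∈ F, cornerCube (M / T) (T⁻¹ • formCast v)) ⊆
      Metric.cthickening (M / T) R := by
    refine Set.iUnion₂_subset fun v hv z hz => ?_
    refine Metric.mem_cthickening_of_dist_le z _ _ R (hF v hv).2 ?_
    obtain ⟨⟨h1, h2⟩, h3, h4⟩ := hz
    have aux : ∀ {s t : ℝ}, t ∈ Ico s (s + M / T) → dist t s ≤ M / T := by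
      intro s t h
      rw [Real.dist_eq, abs_of_nonneg (by linarith [h.1])]
      linarith [h.2]
    exact max_le (max_le (aux h1) (aux h2)) (max_le (aux h3) (aux h4))
  have hvol := (measure_mono hsub).trans hT.le
  rw [measure_biUnion_finset hdisj fun v _ => measurableSet_cornerCube _ _] at hvol
  simp_rw [volume_cornerCube (div_nonneg hMr.le hT0.le)] at hvol
  rw [Finset.sum_const, nsmul_eq_mul, ← ENNReal.ofReal_natCast,
    ← ENNReal.ofReal_mul (by positivity)] at hvol
  have := (ENNReal.ofReal_le_ofReal_iff (by positivity)).1 hvol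
  rw [div_pow, ← mul_div_assoc, div_le_iff₀ (by positivity)] at this
  exact this

end LatticePoints

section Cusp

theorem reduced_form_bounds {a b c d T : ℝ} (hB : |b * c - a * d| ≤ b ^ 2 - a * c)
    (hC : b ^ 2 - a * c ≤ c ^ 2 - b * d)
    (hpos : 0 < 4 * (b ^ 2 - a * c) * (c ^ 2 - b * d) - (b * c - a * d) ^ 2)
    (hT : 4 * (b ^ 2 - a * c) * (c ^ 2 - b * d) - (b * c - a * d) ^ 2 ≤ T ^ 4) :
    0 < b ^ 2 - a * c ∧ 1 ≤ (c ^ 2 - b * d) / (b ^ 2 - a * c) ∧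
      ((c ^ 2 - b * d) / (b ^ 2 - a * c)) ^ 3 * a ^ 4 ≤ T ^ 4 ∧
      b ^ 4 * ((c ^ 2 - b * d) / (b ^ 2 - a * c)) ≤ T ^ 4 ∧
      |c| ≤ |b| + (c ^ 2 - b * d) / (b ^ 2 - a * c) * |a| ∧
      |d| ≤ |c| + (c ^ 2 - b * d) / (b ^ 2 - a * c) * |b| := by
  have e1 : c * (b ^ 2 - a * c) = b * (b * c - a * d) - a * (c ^ 2 - b * d) := by ring
  have e2 : d * (b ^ 2 - a * c) = c * (b * c - a * d) - b * (c ^ 2 - b * d) := by ring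
  have e3 : (b ^ 2 - a * c) * (b ^ 2 - a * c) =
    b ^ 2 * (b ^ 2 - a * c) - a * b * (b * c - a * d) + a ^ 2 * (c ^ 2 - b * d) := by ring
  set A := b ^ 2 - a * c
  set B := b * c - a * d
  set C := c ^ 2 - b * d
  have hA0 : 0 ≤ A := (abs_nonneg _).trans hB
  have hA : 0 < A := by
    rcases hA0.lt_or_eq with h | h
    · exact h
    · rw [← h] at hpos
      nlinarith [sq_nonneg B]
  set q := C / A with hq
  have hqA : C = q * A := by rw [hq]; field_simp
  have hq1 : 1 ≤ q := by rw [hq, one_le_div hA]; exact hC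
  have hBabs := abs_le.1 hB
  have hA2q : 3 * (A ^ 2 * q) ≤ T ^ 4 := by
    have hB2 : B ^ 2 ≤ A ^ 2 := sq_le_sq' hBabs.1 hBabs.2
    have : A ^ 2 ≤ A ^ 2 * q := le_mul_of_one_le_right (sq_nonneg _) hq1
    rw [hqA] at hT
    nlinarith
  have habB : a * b * B ≤ |a| * |b| * A := by
    calc a * b * B ≤ |a * b * B| := le_abs_self _
      _ = |a| * |b| * |B| := by rw [abs_mul, abs_mul]
      _ ≤ _ := by gcongr
  have hAlow : b ^ 2 - |a| * |b| + q * a ^ 2 ≤ A := by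
    rw [hqA] at e3
    have : (b ^ 2 - |a| * |b| + q * a ^ 2) * A ≤ A * A := by nlinarith
    exact le_of_mul_le_mul_right this hA
  have hqa : q * a ^ 2 ≤ 4 / 3 * A := by
    have h1 : |a| ^ 2 ≤ q * |a| ^ 2 := le_mul_of_one_le_left (sq_nonneg _) hq1
    rw [← sq_abs a, ← sq_abs b] at hAlow
    rw [← sq_abs a]
    nlinarith [sq_nonneg (|b| - |a| / 2)]
  have hb : b ^ 2 ≤ 4 / 3 * A := by
    have h1 : |a| ^ 2 ≤ q * |a| ^ 2 := le_mul_of_one_le_left (sq_nonneg _) hq1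
    rw [← sq_abs a, ← sq_abs b] at hAlow
    rw [← sq_abs b]
    nlinarith [sq_nonneg (|a| - |b| / 2)]
  have hA2q0 : 0 ≤ A ^ 2 * q := by positivity
  refine ⟨hA, hq1, ?_, ?_, ?_, ?_⟩
  · have : (q * a ^ 2) ^ 2 ≤ (4 / 3 * A) ^ 2 := by gcongr
    nlinarith
  · have : (b ^ 2) ^ 2 ≤ (4 / 3 * A) ^ 2 := by gcongr
    nlinarith
  · have : |c| * A ≤ (|b| + q * |a|) * A := by
      calc |c| * A = |c * A| := by rw [abs_mul, abs_of_pos hA]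
        _ = |b * B - a * C| := by rw [e1]
        _ ≤ |b| * |B| + |a| * |C| := by rw [← abs_mul, ← abs_mul]; exact abs_sub _ _
        _ ≤ |b| * A + |a| * (q * A) := by
          rw [hqA, abs_of_nonneg (show 0 ≤ q * A by positivity)]
          gcongr
        _ = _ := by ring
    exact le_of_mul_le_mul_right this hA
  · have : |d| * A ≤ (|c| + q * |b|) * A := by
      calc |d| * A = |d * A| := by rw [abs_mul, abs_of_pos hA]
        _ = |c * B - b * C| := by rw [e2]
        _ ≤ |c| * |B| + |b| * |C| := by rw [← abs_mul, ← abs_mul]; exact abs_sub _ _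
        _ ≤ |c| * A + |b| * (q * A) := by
          rw [hqA, abs_of_nonneg (show 0 ≤ q * A by positivity)]
          gcongr
        _ = _ := by ring
    exact le_of_mul_le_mul_right this hA

theorem Finset.card_int_le_of_mem_Icc (G : Finset ℤ) {s t : ℝ} (hst : s ≤ t)
    (hG : ∀ x ∈ G, s ≤ x ∧ (x : ℝ) ≤ t) : (G.card : ℝ) ≤ t - s + 1 := by
  have hsub : G ⊆ Finset.Icc ⌈s⌉ ⌊t⌋ := fun x hx =>
    Finset.mem_Icc.2 ⟨Int.ceil_le.2 (hG x hx).1, Int.le_floor.2 (hG x hx).2⟩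
  have h1 : (G.card : ℝ) ≤ ((⌊t⌋ + 1 - ⌈s⌉).toNat : ℝ) := by
    rw [← Int.card_Icc]
    exact_mod_cast Finset.card_le_card hsub
  refine h1.trans ?_
  have h2 : (((⌊t⌋ + 1 - ⌈s⌉).toNat : ℤ) : ℝ) ≤ t - s + 1 := by
    rw [Int.toNat_eq_max]
    push_cast
    refine max_le ?_ (by linarith)
    linarith [Int.floor_le t, Int.le_ceil s]
  exact_mod_cast h2

theorem Finset.card_le_sum_image_of_fiber_le {α β : Type*} [DecidableEq β] (F : Finset α)
    (f : α → β) (g : β → ℝ) (h : ∀ y ∈ F.image f, ((F.filter fun x => f x = y).card : ℝ) ≤ g y) :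
    (F.card : ℝ) ≤ ∑ y ∈ F.image f, g y := by
  rw [Finset.card_eq_sum_card_image f F]
  push_cast
  exact Finset.sum_le_sum h

theorem Finset.card_le_mul_of_fiber_le {α β : Type*} [DecidableEq β] (F : Finset α)
    (f : α → β) {m n : ℝ} (hm : ((F.image f).card : ℝ) ≤ m) (hn : 0 ≤ n)
    (h : ∀ y ∈ F.image f, ((F.filter fun x => f x = y).card : ℝ) ≤ n) :
    (F.card : ℝ) ≤ m * n := by
  refine (F.card_le_sum_image_of_fiber_le f (fun _ => n) h).trans ?_
  rw [Finset.sum_const, nsmul_eq_mul]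
  gcongr

theorem card_reduced_tails_le {a b : ℤ} (ha : a ≠ 0) {T : ℝ} (G : Finset (ℤ × ℤ))
    (hG : ∀ w ∈ G, |b * w.1 - a * w.2| ≤ b ^ 2 - a * w.1 ∧
      b ^ 2 - a * w.1 ≤ w.1 ^ 2 - b * w.2 ∧
      0 < 4 * (b ^ 2 - a * w.1) * (w.1 ^ 2 - b * w.2) - (b * w.1 - a * w.2) ^ 2 ∧
      ((4 * (b ^ 2 - a * w.1) * (w.1 ^ 2 - b * w.2) - (b * w.1 - a * w.2) ^ 2 : ℤ) : ℝ) ≤ T ^ 4) :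
    (G.card : ℝ) ^ 3 * (a : ℝ) ^ 2 ≤ 35 ^ 3 * T ^ 8 := by
  rcases G.eq_empty_or_nonempty with rfl | hne
  · simp
    positivity
  set q : ℤ × ℤ → ℝ := fun w => ((w.1 : ℝ) ^ 2 - b * w.2) / ((b : ℝ) ^ 2 - a * w.1) with hq
  have hbd : ∀ w ∈ G, 0 < (b : ℝ) ^ 2 - a * w.1 ∧ 1 ≤ q w ∧ q w ^ 3 * (a : ℝ) ^ 4 ≤ T ^ 4 ∧
      (b : ℝ) ^ 4 * q w ≤ T ^ 4 ∧ |(w.1 : ℝ)| ≤ |(b : ℝ)| + q w * |(a : ℝ)| ∧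
      |(w.2 : ℝ)| ≤ |(w.1 : ℝ)| + q w * |(b : ℝ)| := by
    intro w hw
    obtain ⟨h1, h2, h3, h4⟩ := hG w hw
    refine reduced_form_bounds ?_ ?_ ?_ ?_
    · exact_mod_cast h1
    · exact_mod_cast h2
    · exact_mod_cast h3
    · exact_mod_cast h4
  obtain ⟨w₀, hw₀, hmax⟩ := G.exists_max_image q hne
  set Q := q w₀ with hQ
  obtain ⟨-, hQ1, hQa, hQb, -, -⟩ := hbd w₀ hw₀
  have ha1 : (1 : ℝ) ≤ |(a : ℝ)| := by exact_mod_cast Int.one_le_abs ha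
  have hc : ∀ w ∈ G, |(w.1 : ℝ)| ≤ |(b : ℝ)| + Q * |(a : ℝ)| := by
    intro w hw
    refine (hbd w hw).2.2.2.2.1.trans ?_
    gcongr
    exact hmax w hw
  have hd : ∀ w ∈ G, |(w.2 : ℝ)| ≤ |(w.1 : ℝ)| + Q * |(b : ℝ)| := by
    intro w hw
    refine (hbd w hw).2.2.2.2.2.trans ?_
    gcongr
    exact hmax w hw
  have hQQ : Q ≤ Q ^ 2 := by nlinarith
  have hu : (Q * (b : ℝ) ^ 2) ^ 3 * (a : ℝ) ^ 2 ≤ T ^ 8 := by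
    refine le_of_abs_le (abs_le_of_sq_le_sq ?_ (by positivity))
    calc _ = ((b : ℝ) ^ 4 * Q) ^ 3 * (Q ^ 3 * (a : ℝ) ^ 4) := by ring
      _ ≤ (T ^ 4) ^ 3 * T ^ 4 := by gcongr
      _ = _ := by ring
  have hw : (Q ^ 2 * (a : ℝ) ^ 2) ^ 3 * (a : ℝ) ^ 2 ≤ T ^ 8 := by
    calc _ = (Q ^ 3 * (a : ℝ) ^ 4) ^ 2 := by ring
      _ ≤ (T ^ 4) ^ 2 := by gcongr
      _ = _ := by ring
  have hcard : (G.card : ℝ) ≤ 35 * max (Q * (b : ℝ) ^ 2) (Q ^ 2 * (a : ℝ) ^ 2) := by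
    rcases le_or_gt |(b : ℝ)| (Q * |(a : ℝ)|) with hba | hba
    · have h1 : (G.card : ℝ) ≤ (5 * (Q * |(a : ℝ)|)) *
          (2 * (((b : ℝ) ^ 2 + 2 * Q * (a : ℝ) ^ 2) / |(a : ℝ)|) + 1) := by
        refine G.card_le_mul_of_fiber_le Prod.fst ?_ (by positivity) ?_
        · have := (G.image Prod.fst).card_int_le_of_mem_Icc (s := -(2 * (Q * |(a : ℝ)|)))
            (t := 2 * (Q * |(a : ℝ)|)) (by nlinarith) ?_
          · nlinarith
          · intro x hx
            obtain ⟨w, hw, rfl⟩ := Finset.mem_image.1 hx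
            have := abs_le.1 (hc w hw)
            constructor <;> linarith [this.1, this.2]
        · intro c hcG
          obtain ⟨w₁, hw₁, rfl⟩ := Finset.mem_image.1 hcG
          set s := ((b : ℝ) ^ 2 + 2 * Q * (a : ℝ) ^ 2) / |(a : ℝ)| with hs
          have hcard : (G.filter fun w => w.1 = w₁.1).card =
              ((G.filter fun w => w.1 = w₁.1).image Prod.snd).card := by
            rw [Finset.card_image_of_injOn]
            intro x hx y hy hxy
            have hx' := (Finset.mem_filter.1 hx).2
            have hy' := (Finset.mem_filter.1 hy).2
            exact Prod.ext (hx'.trans hy'.symm) hxy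
          rw [hcard]
          have := Finset.card_int_le_of_mem_Icc
            ((G.filter fun w => w.1 = w₁.1).image Prod.snd) (s := (b : ℝ) * w₁.1 / a - s)
            (t := (b : ℝ) * w₁.1 / a + s)
            (by have : 0 ≤ s := by positivity
                linarith) ?_
          · linarith
          · intro x hx
            obtain ⟨w, hw, rfl⟩ := Finset.mem_image.1 hx
            obtain ⟨hw, hww⟩ := Finset.mem_filter.1 hw
            have hA : |(b : ℝ) * w.1 - a * w.2| ≤ (b : ℝ) ^ 2 - a * w.1 := by
              exact_mod_cast (hG w hw).1
            have hA2 : (b : ℝ) ^ 2 - a * w.1 ≤ (b : ℝ) ^ 2 + 2 * Q * (a : ℝ) ^ 2 := by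
              have h1 : -((a : ℝ) * w.1) ≤ |(a : ℝ)| * |(w.1 : ℝ)| := by
                rw [← abs_mul]
                exact neg_le_abs _
              have h2 : |(a : ℝ)| * |(w.1 : ℝ)| ≤ |(a : ℝ)| * (2 * (Q * |(a : ℝ)|)) := by
                gcongr
                linarith [hc w hw]
              have h3 : |(a : ℝ)| * (2 * (Q * |(a : ℝ)|)) = 2 * Q * (a : ℝ) ^ 2 := by
                rw [← sq_abs (a : ℝ)]
                ring
              linarith
            have har : (a : ℝ) ≠ 0 := by exact_mod_cast ha
            have hdist : |(w.2 : ℝ) - b * w₁.1 / a| ≤ s := by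
              rw [hs, le_div_iff₀ (by positivity), ← abs_mul, ← hww]
              have : ((w.2 : ℝ) - b * w.1 / a) * a = -((b : ℝ) * w.1 - a * w.2) := by
                field_simp
                ring
              rw [this, abs_neg]
              exact hA.trans hA2
            have := abs_le.1 hdist
            constructor <;> linarith [this.1, this.2]
      have h2 : (5 * (Q * |(a : ℝ)|)) *
          (2 * (((b : ℝ) ^ 2 + 2 * Q * (a : ℝ) ^ 2) / |(a : ℝ)|) + 1) =
          10 * (Q * (b : ℝ) ^ 2) + 20 * (Q ^ 2 * (a : ℝ) ^ 2) + 5 * (Q * |(a : ℝ)|) := by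
        field_simp
        ring
      have h3 : Q * |(a : ℝ)| ≤ Q ^ 2 * (a : ℝ) ^ 2 := by
        rw [← sq_abs (a : ℝ)]
        have : |(a : ℝ)| ≤ |(a : ℝ)| ^ 2 := by nlinarith
        gcongr
      have h4 := le_max_left (Q * (b : ℝ) ^ 2) (Q ^ 2 * (a : ℝ) ^ 2)
      have h5 := le_max_right (Q * (b : ℝ) ^ 2) (Q ^ 2 * (a : ℝ) ^ 2)
      linarith
    · have hb1 : (1 : ℝ) ≤ |(b : ℝ)| := by nlinarith
      have hQb : |(b : ℝ)| ≤ Q * |(b : ℝ)| := le_mul_of_one_le_left (abs_nonneg _) hQ1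
      have h1 : (G.card : ℝ) ≤ (5 * |(b : ℝ)|) * (7 * (Q * |(b : ℝ)|)) := by
        refine G.card_le_mul_of_fiber_le Prod.fst ?_ (by positivity) ?_
        · have := (G.image Prod.fst).card_int_le_of_mem_Icc (s := -(2 * |(b : ℝ)|))
            (t := 2 * |(b : ℝ)|) (by linarith) ?_
          · linarith
          · intro x hx
            obtain ⟨w, hw, rfl⟩ := Finset.mem_image.1 hx
            have := abs_le.1 (hc w hw)
            constructor <;> linarith [this.1, this.2]
        · intro c hcG
          obtain ⟨w₁, hw₁, rfl⟩ := Finset.mem_image.1 hcG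
          have hcard : (G.filter fun w => w.1 = w₁.1).card =
              ((G.filter fun w => w.1 = w₁.1).image Prod.snd).card := by
            rw [Finset.card_image_of_injOn]
            intro x hx y hy hxy
            have hx' := (Finset.mem_filter.1 hx).2
            have hy' := (Finset.mem_filter.1 hy).2
            exact Prod.ext (hx'.trans hy'.symm) hxy
          rw [hcard]
          have := Finset.card_int_le_of_mem_Icc
            ((G.filter fun w => w.1 = w₁.1).image Prod.snd) (s := -(3 * (Q * |(b : ℝ)|)))
            (t := 3 * (Q * |(b : ℝ)|)) (by linarith) ?_
          · linarith
          · intro x hx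
            obtain ⟨w, hw, rfl⟩ := Finset.mem_image.1 hx
            obtain ⟨hw, hww⟩ := Finset.mem_filter.1 hw
            have h1 := hd w hw
            have h2 := hc w hw
            have := abs_le.1 (h1.trans (add_le_add_left h2 _))
            constructor <;> linarith [this.1, this.2]
      refine h1.trans ?_
      have h2 : (5 * |(b : ℝ)|) * (7 * (Q * |(b : ℝ)|)) = 35 * (Q * (b : ℝ) ^ 2) := by
        rw [← sq_abs (b : ℝ)]
        ring
      rw [h2]
      gcongr
      exact le_max_left _ _
  calc (G.card : ℝ) ^ 3 * (a : ℝ) ^ 2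
      ≤ (35 * max (Q * (b : ℝ) ^ 2) (Q ^ 2 * (a : ℝ) ^ 2)) ^ 3 * (a : ℝ) ^ 2 := by gcongr
    _ = 35 ^ 3 * ((max (Q * (b : ℝ) ^ 2) (Q ^ 2 * (a : ℝ) ^ 2)) ^ 3 * (a : ℝ) ^ 2) := by ring
    _ ≤ 35 ^ 3 * T ^ 8 := by
        gcongr
        rcases max_cases (Q * (b : ℝ) ^ 2) (Q ^ 2 * (a : ℝ) ^ 2) with ⟨h, -⟩ | ⟨h, -⟩
        · rw [h]; exact hu
        · rw [h]; exact hw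

theorem sum_Icc_rpow_le (N : ℕ) :
    ∑ n ∈ Finset.Icc 1 N, (n : ℝ) ^ (-(2 / 3) : ℝ) ≤ 3 * (N : ℝ) ^ (1 / 3 : ℝ) := by
  induction N with
  | zero => simp
  | succ N ih =>
    rw [Finset.sum_Icc_succ_top (by omega)]
    set y := ((N + 1 : ℕ) : ℝ) ^ (1 / 3 : ℝ) with hy
    set x := (N : ℝ) ^ (1 / 3 : ℝ) with hx
    have hx0 : 0 ≤ x := by positivity
    have hy0 : 0 < y := by positivity
    have hx3 : x ^ 3 = N := by
      rw [hx, ← Real.rpow_mul_natCast (by positivity)]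
      norm_num
    have hy3 : y ^ 3 = N + 1 := by
      rw [hy, ← Real.rpow_mul_natCast (by positivity)]
      norm_num
    have hxy : x ≤ y := by
      rw [hx, hy]
      gcongr
      linarith
    have hy2 : ((N + 1 : ℕ) : ℝ) ^ (-(2 / 3) : ℝ) = (y ^ 2)⁻¹ := by
      rw [Real.rpow_neg (by positivity), hy, ← Real.rpow_mul_natCast (by positivity)]
      norm_num
    rw [hy2]
    have : (y ^ 2)⁻¹ ≤ 3 * y - 3 * x := by
      rw [inv_le_iff_one_le_mul₀ (by positivity)]
      have h1 : (y - x) * (y ^ 2 + x * y + x ^ 2) = 1 := by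
        have : (y - x) * (y ^ 2 + x * y + x ^ 2) = y ^ 3 - x ^ 3 := by ring
        rw [this, hx3, hy3]
        ring
      have h2 : (y - x) * (y ^ 2 + x * y + x ^ 2) ≤ (y - x) * (3 * y ^ 2) := by
        apply mul_le_mul_of_nonneg_left _ (by linarith)
        nlinarith
      nlinarith
    linarith

theorem le_rpow_of_cube_mul_sq_le {g a T K : ℝ} (ha : 0 < a) (hT : 0 ≤ T) (hK : 0 ≤ K)
    (h : g ^ 3 * a ^ 2 ≤ K ^ 3 * T ^ 8) :
    g ≤ K * (T ^ (8 / 3 : ℝ) * a ^ (-(2 / 3) : ℝ)) := by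
  apply le_of_pow_le_pow_left₀ (n := 3) (by norm_num) (by positivity)
  have h1 : (T ^ (8 / 3 : ℝ)) ^ 3 = T ^ 8 := by
    rw [← Real.rpow_mul_natCast hT, ← Real.rpow_natCast]
    norm_num
  have h2 : (a ^ (-(2 / 3) : ℝ)) ^ 3 = (a ^ 2)⁻¹ := by
    rw [← Real.rpow_mul_natCast ha.le, ← Real.rpow_natCast, ← Real.rpow_neg ha.le]
    norm_num
  rw [mul_pow, mul_pow, h1, h2, ← mul_assoc, le_mul_inv_iff₀ (by positivity)]
  exact h

theorem card_cuspidal_forms_le {η T : ℝ} (hη : 0 ≤ η) (hT : 1 ≤ T)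
    (F : Finset ((ℤ × ℤ) × (ℤ × ℤ)))
    (hF : ∀ v ∈ F, v.1.1 ≠ 0 ∧ |(v.1.1 : ℝ)| ≤ η * T ∧
      |v.1.2 * v.2.1 - v.1.1 * v.2.2| ≤ v.1.2 ^ 2 - v.1.1 * v.2.1 ∧
      v.1.2 ^ 2 - v.1.1 * v.2.1 ≤ v.2.1 ^ 2 - v.1.2 * v.2.2 ∧
      0 < 4 * (v.1.2 ^ 2 - v.1.1 * v.2.1) * (v.2.1 ^ 2 - v.1.2 * v.2.2) -
        (v.1.2 * v.2.1 - v.1.1 * v.2.2) ^ 2 ∧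
      ((4 * (v.1.2 ^ 2 - v.1.1 * v.2.1) * (v.2.1 ^ 2 - v.1.2 * v.2.2) -
        (v.1.2 * v.2.1 - v.1.1 * v.2.2) ^ 2 : ℤ) : ℝ) ≤ T ^ 4) :
    (F.card : ℝ) ≤ 630 * η ^ (1 / 3 : ℝ) * T ^ 4 := by
  have hT0 : 0 < T := by linarith
  have h1 : (F.card : ℝ) ≤ ∑ n ∈ F.image (fun v => v.1.1.natAbs),
      2 * (3 * T * (35 * (T ^ (8 / 3 : ℝ) * (n : ℝ) ^ (-(2 / 3) : ℝ)))) := by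
    refine F.card_le_sum_image_of_fiber_le _ _ fun n hn => ?_
    refine Finset.card_le_mul_of_fiber_le _ (fun v => v.1.1) ?_ (by positivity) fun a ha => ?_
    · have : (Finset.image (fun v => v.1.1) (F.filter fun v => v.1.1.natAbs = n)) ⊆
          {(n : ℤ), -(n : ℤ)} := by
        intro a ha
        obtain ⟨v, hv, rfl⟩ := Finset.mem_image.1 ha
        have := (Finset.mem_filter.1 hv).2
        simp only [Finset.mem_insert, Finset.mem_singleton]
        omega
      exact_mod_cast (Finset.card_le_card this).trans Finset.card_le_two
    · obtain ⟨v₀, hv₀, rfl⟩ := Finset.mem_image.1 ha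
      have hn0 : (n : ℝ) = |(v₀.1.1 : ℝ)| := by
        rw [← (Finset.mem_filter.1 hv₀).2, Nat.cast_natAbs, Int.cast_abs]
      refine Finset.card_le_mul_of_fiber_le _ (fun v => v.1.2) ?_ (by positivity) fun b hb => ?_
      · have := Finset.card_int_le_of_mem_Icc (Finset.image (fun v => v.1.2)
          ((F.filter fun v => v.1.1.natAbs = n).filter fun v => v.1.1 = v₀.1.1)) (s := -T) (t := T)
          (by linarith) ?_
        · linarith
        · intro b hb
          obtain ⟨v, hv, rfl⟩ := Finset.mem_image.1 hb
          obtain ⟨h1, h2, h3, h4, h5, h6⟩ := hF v (Finset.mem_filter.1 (Finset.mem_filter.1 hv).1).1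
          obtain ⟨-, hq, -, hbq, -⟩ := reduced_form_bounds (a := v.1.1) (b := v.1.2) (c := v.2.1)
            (d := v.2.2) (T := T) (by exact_mod_cast h3) (by exact_mod_cast h4)
            (by exact_mod_cast h5) (by exact_mod_cast h6)
          have : (v.1.2 : ℝ) ^ 4 ≤ T ^ 4 :=
            (le_mul_of_one_le_right (by positivity) hq).trans hbq
          have h4' : |(v.1.2 : ℝ)| ^ 4 ≤ T ^ 4 := by
            rwa [Even.pow_abs (by decide)]
          exact abs_le.1 (le_of_pow_le_pow_left₀ (by norm_num) hT0.le h4')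
      · obtain ⟨v₁, hv₁, rfl⟩ := Finset.mem_image.1 hb
        set H := ((F.filter fun v => v.1.1.natAbs = n).filter fun v => v.1.1 = v₀.1.1).filter
          fun v => v.1.2 = v₁.1.2 with hH
        have hHmem : ∀ v ∈ H, v ∈ F ∧ v.1.1 = v₀.1.1 ∧ v.1.2 = v₁.1.2 := by
          intro v hv
          simp only [hH, Finset.mem_filter] at hv
          exact ⟨hv.1.1.1, hv.1.2, hv.2⟩
        have hcard : H.card = (H.image Prod.snd).card := by
          rw [Finset.card_image_of_injOn]
          intro x hx y hy hxy
          obtain ⟨-, h1, h2⟩ := hHmem x hx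
          obtain ⟨-, h3, h4⟩ := hHmem y hy
          exact Prod.ext (Prod.ext (h1.trans h3.symm) (h2.trans h4.symm)) hxy
        have ha0 : v₀.1.1 ≠ 0 := (hF v₀ (Finset.mem_filter.1 hv₀).1).1
        rw [hcard]
        apply le_rpow_of_cube_mul_sq_le _ hT0.le (by norm_num)
        · rw [hn0, sq_abs]
          apply card_reduced_tails_le (b := v₁.1.2) ha0
          intro w hw
          obtain ⟨v, hv, rfl⟩ := Finset.mem_image.1 hw
          obtain ⟨hvF, h1, h2⟩ := hHmem v hv
          rw [← h1, ← h2]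
          exact (hF v hvF).2.2
        · rw [hn0]
          exact abs_pos.2 (by exact_mod_cast ha0)
  refine h1.trans ?_
  have hsub : F.image (fun v => v.1.1.natAbs) ⊆ Finset.Icc 1 ⌊η * T⌋₊ := by
    intro n hn
    obtain ⟨v, hv, rfl⟩ := Finset.mem_image.1 hn
    obtain ⟨h1, h2, -⟩ := hF v hv
    refine Finset.mem_Icc.2 ⟨Int.natAbs_pos.2 h1, Nat.le_floor ?_⟩
    rwa [Nat.cast_natAbs, Int.cast_abs]
  have e : (η * T) ^ (1 / 3 : ℝ) = η ^ (1 / 3 : ℝ) * T ^ (1 / 3 : ℝ) :=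
    Real.mul_rpow hη hT0.le
  have e2 : T * T ^ (8 / 3 : ℝ) * T ^ (1 / 3 : ℝ) = T ^ 4 := by
    rw [mul_assoc, ← Real.rpow_add hT0, ← Real.rpow_natCast T 4]
    nth_rewrite 1 [← Real.rpow_one T]
    rw [← Real.rpow_add hT0]
    norm_num
  calc _ ≤ ∑ n ∈ Finset.Icc 1 ⌊η * T⌋₊,
        2 * (3 * T * (35 * (T ^ (8 / 3 : ℝ) * (n : ℝ) ^ (-(2 / 3) : ℝ)))) :=
        Finset.sum_le_sum_of_subset_of_nonneg hsub fun _ _ _ => by positivity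
    _ = 210 * (T * T ^ (8 / 3 : ℝ)) *
        ∑ n ∈ Finset.Icc 1 ⌊η * T⌋₊, (n : ℝ) ^ (-(2 / 3) : ℝ) := by
        rw [Finset.mul_sum]
        exact Finset.sum_congr rfl fun _ _ => by ring
    _ ≤ 210 * (T * T ^ (8 / 3 : ℝ)) * (3 * (⌊η * T⌋₊ : ℝ) ^ (1 / 3 : ℝ)) := by
        gcongr
        exact sum_Icc_rpow_le _
    _ ≤ 210 * (T * T ^ (8 / 3 : ℝ)) * (3 * (η * T) ^ (1 / 3 : ℝ)) := by
        gcongr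
        exact Nat.floor_le (by positivity)
    _ = 630 * η ^ (1 / 3 : ℝ) * T ^ 4 := by
        rw [e, ← e2]
        ring

end Cusp

section ReducedForms
open MeasureTheory Set

/-- The discriminant, up to a factor `27`, of the cubic form `a x³ + 3 b x² y + 3 c x y² + d y³`
given by `((a, b), (c, d))`. -/
def cubicDisc {R : Type*} [CommRing R] (v : (R × R) × (R × R)) : R :=
  (v.1.2 * v.2.1 - v.1.1 * v.2.2) ^ 2 -
    4 * (v.1.2 ^ 2 - v.1.1 * v.2.1) * (v.2.1 ^ 2 - v.1.2 * v.2.2)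

/-- Integral cubic forms with nonzero leading coefficient and reduced Hessian. -/
def IsReducedForm (v : (ℤ × ℤ) × (ℤ × ℤ)) : Prop :=
  v.1.1 ≠ 0 ∧ |v.1.2 * v.2.1 - v.1.1 * v.2.2| ≤ v.1.2 ^ 2 - v.1.1 * v.2.1 ∧
    v.1.2 ^ 2 - v.1.1 * v.2.1 ≤ v.2.1 ^ 2 - v.1.2 * v.2.2

theorem smul_formCast_mem_reducedForms {v : (ℤ × ℤ) × (ℤ × ℤ)} (hv : IsReducedForm v)
    (hneg : cubicDisc v < 0) {η T : ℝ} (hT : 0 < T) (hdisc : ((-cubicDisc v : ℤ) : ℝ) ≤ T ^ 4)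
    (ha : η * T ≤ |(v.1.1 : ℝ)|) : T⁻¹ • formCast v ∈ reducedForms η := by
  obtain ⟨⟨a, b⟩, ⟨c, d⟩⟩ := v
  obtain ⟨-, h1, h2⟩ := hv
  unfold cubicDisc at hneg hdisc
  simp only at h1 h2 hneg hdisc ha
  have g1 : |(b : ℝ) * c - a * d| ≤ (b : ℝ) ^ 2 - a * c := by exact_mod_cast h1
  have g2 : (b : ℝ) ^ 2 - a * c ≤ (c : ℝ) ^ 2 - b * d := by exact_mod_cast h2
  have g3 : 4 * ((b : ℝ) ^ 2 - a * c) * ((c : ℝ) ^ 2 - b * d) - ((b : ℝ) * c - a * d) ^ 2 ≤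
      T ^ 4 := by
    push_cast at hdisc
    linarith
  have g4 : 0 < 4 * ((b : ℝ) ^ 2 - a * c) * ((c : ℝ) ^ 2 - b * d) -
      ((b : ℝ) * c - a * d) ^ 2 := by
    have : (0 : ℝ) <
        ((-((b * c - a * d) ^ 2 - 4 * (b ^ 2 - a * c) * (c ^ 2 - b * d)) : ℤ) : ℝ) := by
      exact_mod_cast (by linarith)
    push_cast at this
    linarith
  obtain ⟨hA, hq, -⟩ := reduced_form_bounds g1 g2 g4 g3
  have hA0 := hA.ne'
  have hlead : hessianLead (T⁻¹ * (a : ℝ), T⁻¹ * (b : ℝ))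
      (-((b : ℝ) * c - a * d) / ((b : ℝ) ^ 2 - a * c),
        ((c : ℝ) ^ 2 - b * d) / ((b : ℝ) ^ 2 - a * c)) = ((b : ℝ) ^ 2 - a * c) / T ^ 2 := by
    unfold hessianLead
    simp only
    generalize hAd : (b : ℝ) ^ 2 - a * c = A at hA0 ⊢
    field_simp
    rw [← hAd]
    ring
  refine ⟨((T⁻¹ * (a : ℝ), T⁻¹ * (b : ℝ)), (-((b : ℝ) * c - a * d) / ((b : ℝ) ^ 2 - a * c),
    ((c : ℝ) ^ 2 - b * d) / ((b : ℝ) ^ 2 - a * c))), ⟨?_, ?_, hq, ?_⟩, ?_⟩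
  · simp only
    rw [abs_mul, abs_of_pos (inv_pos.2 hT), inv_mul_eq_div, le_div_iff₀ hT]
    exact ha
  · simp only
    rw [neg_div, abs_neg, abs_div, abs_of_pos hA, div_le_one hA]
    exact g1
  · simp only [hlead]
    have : (((b : ℝ) ^ 2 - a * c) / T ^ 2) ^ 2 * (4 * (((c : ℝ) ^ 2 - b * d) /
        ((b : ℝ) ^ 2 - a * c)) - (-((b : ℝ) * c - a * d) / ((b : ℝ) ^ 2 - a * c)) ^ 2) =
        (4 * ((b : ℝ) ^ 2 - a * c) * ((c : ℝ) ^ 2 - b * d) -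
      ((b : ℝ) * c - a * d) ^ 2) / T ^ 4 := by
      field_simp
    rw [this, div_le_one (by positivity)]
    exact g3
  · simp only [formCast, cubicTail, Prod.smul_mk, smul_eq_mul, Prod.mk.injEq, true_and]
    generalize hAd : (b : ℝ) ^ 2 - a * c = A at hA0 ⊢
    constructor
    · field_simp
      rw [← hAd]
      ring
    · field_simp
      rw [← hAd]
      ring

theorem card_reduced_forms_le (M : ℕ) [NeZero M] {ε : ℝ} (hε : 0 < ε) :
    ∀ᶠ T : ℝ in Filter.atTop, ∀ S : Finset ((ZMod M × ZMod M) × (ZMod M × ZMod M)),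
      ∀ F : Finset ((ℤ × ℤ) × (ℤ × ℤ)),
      (∀ v ∈ F, IsReducedForm v ∧ cubicDisc v < 0 ∧ ((-cubicDisc v : ℤ) : ℝ) ≤ T ^ 4 ∧
        formMod M v ∈ S) →
      (F.card : ℝ) ≤ (π ^ 2 / 6 * (S.card / (M : ℝ) ^ 4) + ε) * T ^ 4 := by
  have hM : 0 < M := Nat.pos_of_ne_zero (NeZero.ne M)
  have hMr : (0 : ℝ) < M := by exact_mod_cast hM
  set η : ℝ := (ε / 1260) ^ 3 with hη
  have hη0 : 0 < η := by positivity
  have hη3 : 630 * η ^ (1 / 3 : ℝ) = ε / 2 := by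
    rw [hη, ← Real.rpow_natCast_mul (by positivity)]
    norm_num
    ring
  have hvol : (volume (reducedForms η)).toReal ≤ π ^ 2 / 6 :=
    ENNReal.toReal_le_of_le_ofReal (by positivity) (volume_reducedForms_le hη0)
  filter_upwards [card_mul_pow_le_of_isCompact (isCompact_reducedForms hη0) hM
    (half_pos hε), Filter.eventually_ge_atTop (1 : ℝ)] with T hT hT1 S F hF
  have hT0 : 0 < T := by linarith
  have hcusp : ((F.filter fun v => |(v.1.1 : ℝ)| ≤ η * T).card : ℝ) ≤ ε / 2 * T ^ 4 := by
    rw [← hη3]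
    refine card_cuspidal_forms_le hη0.le hT1 _ fun v hv => ?_
    obtain ⟨hvF, hva⟩ := Finset.mem_filter.1 hv
    obtain ⟨⟨h1, h2, h3⟩, h4, h5, -⟩ := hF v hvF
    unfold cubicDisc at h4 h5
    refine ⟨h1, hva, h2, h3, by linarith, ?_⟩
    rwa [neg_sub] at h5
  have hmain : ((F.filter fun v => ¬ |(v.1.1 : ℝ)| ≤ η * T).card : ℝ) ≤
      (π ^ 2 / 6 * (S.card / (M : ℝ) ^ 4) + ε / 2) * T ^ 4 := by
    set G := F.filter fun v => ¬ |(v.1.1 : ℝ)| ≤ η * T with hG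
    have h1 : (G.card : ℝ) ≤ (S.card : ℝ) * ((π ^ 2 / 6 + ε / 2) * T ^ 4 / (M : ℝ) ^ 4) := by
      refine Finset.card_le_mul_of_fiber_le G (formMod M) ?_ (by positivity) fun r _ => ?_
      · have : G.image (formMod M) ⊆ S := by
          intro r hr
          obtain ⟨v, hv, rfl⟩ := Finset.mem_image.1 hr
          exact (hF v (Finset.mem_filter.1 hv).1).2.2.2
        exact_mod_cast Finset.card_le_card this
      · rw [le_div_iff₀ (by positivity)]
        refine (hT r _ fun v hv => ?_).trans (by gcongr)
        obtain ⟨hvG, hvr⟩ := Finset.mem_filter.1 hv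
        obtain ⟨hvF, hva⟩ := Finset.mem_filter.1 hvG
        obtain ⟨h1, h2, h3, -⟩ := hF v hvF
        exact ⟨hvr, smul_formCast_mem_reducedForms h1 h2 hT0 h3 (not_le.1 hva).le⟩
    have h2 : (S.card : ℝ) / (M : ℝ) ^ 4 ≤ 1 := by
      rw [div_le_one (by positivity)]
      have := S.card_le_univ
      simp only [Fintype.card_prod, ZMod.card] at this
      have h3 : S.card ≤ M ^ 4 := by
        refine this.trans (le_of_eq ?_)
        ring
      exact_mod_cast h3
    calc (G.card : ℝ) ≤ _ := h1
      _ = (π ^ 2 / 6 * (S.card / (M : ℝ) ^ 4) + ε / 2 * (S.card / (M : ℝ) ^ 4)) * T ^ 4 := by ring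
      _ ≤ (π ^ 2 / 6 * (S.card / (M : ℝ) ^ 4) + ε / 2 * 1) * T ^ 4 := by gcongr
      _ = _ := by ring
  have hsum := Finset.card_filter_add_card_filter_not (s := F) (fun v => |(v.1.1 : ℝ)| ≤ η * T)
  have hsum' : (F.card : ℝ) = ((F.filter fun v => |(v.1.1 : ℝ)| ≤ η * T).card : ℝ) +
      ((F.filter fun v => ¬ |(v.1.1 : ℝ)| ≤ η * T).card : ℝ) := by
    exact_mod_cast hsum.symm
  rw [hsum']
  linarith

end ReducedForms

section LocalDensity

theorem card_filter_cubicDisc_eq_zero_ge {R : Type*} [CommRing R] [Fintype R]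
    [DecidableEq R] [Nontrivial R]
    (P : Finset R) (h0 : 0 ∈ P) (hP : ∀ x ∈ P, ∀ y ∈ P, x * y = 0) (h2 : IsUnit (2 : R)) :
    Fintype.card Rˣ ^ 2 * Fintype.card R + Fintype.card Rˣ * Fintype.card R * P.card ^ 2 +
      P.card * Fintype.card Rˣ * Fintype.card R + P.card * Fintype.card R ^ 2 +
      (P.card - 1) * P.card ^ 2 * Fintype.card R ≤
    (Finset.univ.filter fun v : (R × R) × (R × R) => cubicDisc v = 0).card := by
  classical
  have hnil : ∀ x ∈ P, ∀ y, IsNilpotent (x * y) := fun x hx y =>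
    ⟨2, by rw [mul_pow, sq, hP x hx x hx, zero_mul]⟩
  have hnu : ∀ x ∈ P, ∀ y, ¬ IsUnit (x * y) := fun x hx y h => (hnil x hx y).not_isUnit h
  have hnu1 : ∀ x ∈ P, ¬ IsUnit x := fun x hx h => hnu x hx 1 (by rwa [mul_one])
  obtain ⟨t2, ht2⟩ := h2
  set Z := Finset.univ.filter fun v : (R × R) × (R × R) => cubicDisc v = 0 with hZ
  have hmemZ : ∀ v, v ∈ Z ↔ cubicDisc v = 0 := fun v => by simp [hZ]
  have c1 : Fintype.card Rˣ ^ 2 * Fintype.card R ≤ ((Z.filter fun v => IsUnit v.1.1).filter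
      fun v => IsUnit (v.1.1 * v.2.1 - v.1.2 ^ 2)).card := by
    have e : Fintype.card Rˣ ^ 2 * Fintype.card R =
        (Finset.univ : Finset ((Rˣ × Rˣ) × R)).card := by
      simp only [Finset.card_univ, Fintype.card_prod]
      ring
    rw [e]
    set α : Rˣ → Rˣ → Rˣ := fun C D => -(t2 ^ 2 * C ^ 3 * (D⁻¹) ^ 2) with hα
    have hαr : ∀ C D : Rˣ, (α C D : R) * (D : R) ^ 2 = -(4 * (C : R) ^ 3) := by
      intro C D
      have h1 : α C D * D ^ 2 = -(t2 ^ 2 * C ^ 3) := by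
        rw [hα, neg_mul, mul_assoc, ← mul_pow, inv_mul_cancel, one_pow, mul_one]
      have h2 := congrArg Units.val h1
      push_cast at h2
      rw [h2, ht2]
      ring
    refine Finset.card_le_card_of_injOn (fun w => (((α w.1.1 w.1.2 : R), (α w.1.1 w.1.2 : R) * w.2),
      ((w.1.1 : R) + α w.1.1 w.1.2 * w.2 ^ 2,
        (w.1.2 : R) + 3 * w.1.1 * w.2 + α w.1.1 w.1.2 * w.2 ^ 3))) ?_ ?_
    · rintro ⟨⟨C, D⟩, t⟩ -
      simp only [Finset.coe_filter, Finset.mem_filter, hmemZ, Set.mem_ofPred_eq]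
      refine ⟨⟨?_, Units.isUnit _⟩, ?_⟩
      · unfold cubicDisc
        linear_combination (α C D : R) * hαr C D
      · have : (α C D : R) * (C + α C D * t ^ 2) - (α C D * t) ^ 2 = ((α C D * C : Rˣ) : R) := by
          push_cast
          ring
        rw [this]
        exact Units.isUnit _
    · rintro ⟨⟨C, D⟩, t⟩ - ⟨⟨C', D'⟩, t'⟩ - h
      simp only [Prod.mk.injEq] at h
      obtain ⟨⟨ha, hb⟩, hc, hd⟩ := h
      rw [← ha] at hb hc hd
      have htt : t = t' := (Units.isUnit _).mul_left_cancel hb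
      subst htt
      have hC : (C : R) = C' := add_right_cancel hc
      rw [hC] at hd
      have hD : (D : R) = D' := add_right_cancel (add_right_cancel hd)
      rw [Units.ext hC, Units.ext hD]
  have c2 : Fintype.card Rˣ * Fintype.card R * P.card ^ 2 ≤
      ((Z.filter fun v => IsUnit v.1.1).filter
        fun v => ¬ IsUnit (v.1.1 * v.2.1 - v.1.2 ^ 2)).card := by
    have e : Fintype.card Rˣ * Fintype.card R * P.card ^ 2 =
        ((Finset.univ : Finset (Rˣ × R)) ×ˢ (P ×ˢ P)).card := by
      simp only [Finset.card_product, Finset.card_univ, Fintype.card_prod]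
      ring
    rw [e]
    refine Finset.card_le_card_of_injOn (fun w => (((w.1.1 : R), w.1.1 * w.1.2),
      (w.2.1 + w.1.1 * w.1.2 ^ 2, w.2.2 + 3 * w.2.1 * w.1.2 + w.1.1 * w.1.2 ^ 3))) ?_ ?_
    · rintro ⟨⟨a, t⟩, ⟨C, D⟩⟩ h
      simp only [Finset.coe_product, Set.mem_prod, Finset.mem_coe, Finset.mem_univ, true_and] at h
      simp only [Finset.coe_filter, Finset.mem_filter, hmemZ, Set.mem_ofPred_eq]
      refine ⟨⟨?_, Units.isUnit _⟩, ?_⟩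
      · unfold cubicDisc
        linear_combination (a : R) ^ 2 * hP D h.2 D h.2 + 4 * a * C * hP C h.1 C h.1
      · have : (a : R) * (C + a * t ^ 2) - (a * t) ^ 2 = C * a := by ring
        rw [this]
        exact hnu C h.1 a
    · rintro ⟨⟨a, t⟩, ⟨C, D⟩⟩ - ⟨⟨a', t'⟩, ⟨C', D'⟩⟩ - h
      simp only [Prod.mk.injEq] at h
      obtain ⟨⟨ha, hb⟩, hc, hd⟩ := h
      have ha' := Units.ext ha
      subst ha'
      have htt : t = t' := (Units.isUnit _).mul_left_cancel hb
      subst htt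
      have hC : C = C' := add_right_cancel hc
      subst hC
      have hD : D = D' := add_right_cancel (add_right_cancel hd)
      rw [hD]
  have c3 : P.card * Fintype.card Rˣ * Fintype.card R ≤
      ((Z.filter fun v => ¬ IsUnit v.1.1).filter fun v => IsUnit v.1.2).card := by
    have e : P.card * Fintype.card Rˣ * Fintype.card R =
        (P ×ˢ (Finset.univ : Finset (Rˣ × R))).card := by
      simp only [Finset.card_product, Finset.card_univ, Fintype.card_prod]
      ring
    rw [e]
    refine Finset.card_le_card_of_injOn (fun w => ((w.1, (w.2.1 : R) + w.1 * w.2.2),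
      (2 * (w.2.1 : R) * w.2.2 + w.1 * w.2.2 ^ 2,
        3 * (w.2.1 : R) * w.2.2 ^ 2 + w.1 * w.2.2 ^ 3))) ?_ ?_
    · rintro ⟨a, ⟨b, t⟩⟩ h
      simp only [Finset.coe_product, Set.mem_prod, Finset.mem_coe] at h
      simp only [Finset.coe_filter, Finset.mem_filter, hmemZ, Set.mem_ofPred_eq]
      refine ⟨⟨?_, hnu1 a h.1⟩, ?_⟩
      · unfold cubicDisc
        ring
      · exact (hnil a h.1 t).isUnit_add_left_of_commute b.isUnit (Commute.all _ _)
    · rintro ⟨a, ⟨b, t⟩⟩ h ⟨a', ⟨b', t'⟩⟩ - he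
      simp only [Finset.coe_product, Set.mem_prod, Finset.mem_coe] at h
      simp only [Prod.mk.injEq] at he
      obtain ⟨⟨rfl, hb⟩, hc, -⟩ := he
      have hu : IsUnit (2 * (b : R) + a * (t - t')) :=
        (hnil a h.1 (t - t')).isUnit_add_left_of_commute
          (by rw [← ht2, ← Units.val_mul]; exact Units.isUnit _)
          (Commute.all _ _)
      have h0 : (2 * (b : R) + a * (t - t')) * (t - t') = 0 := by
        linear_combination hc - 2 * t' * hb
      have htt : t = t' := sub_eq_zero.1 ((hu.mul_right_eq_zero).1 h0)
      subst htt
      rw [Units.ext (add_right_cancel hb)]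
  have c4 : P.card * Fintype.card R ^ 2 ≤ (((Z.filter fun v => ¬ IsUnit v.1.1).filter
      fun v => ¬ IsUnit v.1.2).filter fun v => v.1.1 = 0).card := by
    have e : P.card * Fintype.card R ^ 2 = (P ×ˢ (Finset.univ : Finset (R × R))).card := by
      simp only [Finset.card_product, Finset.card_univ, Fintype.card_prod]
      ring
    rw [e]
    refine Finset.card_le_card_of_injOn (fun w => ((0, w.1), w.2)) ?_ ?_
    · rintro ⟨b, ⟨c, d⟩⟩ h
      simp only [Finset.coe_product, Set.mem_prod, Finset.mem_coe] at h
      simp only [Finset.coe_filter, Finset.mem_filter, hmemZ, Set.mem_ofPred_eq]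
      refine ⟨⟨⟨?_, not_isUnit_zero⟩, hnu1 b h.1⟩, trivial⟩
      unfold cubicDisc
      linear_combination (c ^ 2 - 4 * (c ^ 2 - b * d)) * hP b h.1 b h.1
    · rintro ⟨b, w⟩ - ⟨b', w'⟩ - h
      simp only [Prod.mk.injEq, true_and] at h
      rw [h.1, h.2]
  have c5 : (P.card - 1) * P.card ^ 2 * Fintype.card R ≤ (((Z.filter fun v => ¬ IsUnit v.1.1).filter
      fun v => ¬ IsUnit v.1.2).filter fun v => ¬ v.1.1 = 0).card := by
    have e : (P.card - 1) * P.card ^ 2 * Fintype.card R =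
        (((P.erase 0) ×ˢ P) ×ˢ (P ×ˢ (Finset.univ : Finset R))).card := by
      simp only [Finset.card_product, Finset.card_univ, Finset.card_erase_of_mem h0]
      ring
    rw [e]
    refine Finset.card_le_card_of_injOn id ?_ (Set.injOn_id _)
    rintro ⟨⟨a, b⟩, ⟨c, d⟩⟩ h
    simp only [Finset.coe_product, Set.mem_prod, Finset.mem_coe, Finset.mem_erase] at h
    obtain ⟨⟨⟨ha0, ha⟩, hb⟩, hc, -⟩ := h
    simp only [Finset.coe_filter, Finset.mem_filter, hmemZ, Set.mem_ofPred_eq, id]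
    refine ⟨⟨⟨?_, hnu1 a ha⟩, hnu1 b hb⟩, ha0⟩
    unfold cubicDisc
    linear_combination (c ^ 2 - 4 * (c ^ 2 - b * d)) * hP b hb b hb +
      (d ^ 2) * hP a ha a ha - 2 * c * d * hP a ha b hb + 4 * (c ^ 2 - b * d) * hP a ha c hc
  have s1 := Finset.card_filter_add_card_filter_not (s := Z) (fun v => IsUnit v.1.1)
  have s2 := Finset.card_filter_add_card_filter_not (s := Z.filter fun v => IsUnit v.1.1)
    (fun v => IsUnit (v.1.1 * v.2.1 - v.1.2 ^ 2))
  have s3 := Finset.card_filter_add_card_filter_not (s := Z.filter fun v => ¬ IsUnit v.1.1)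
    (fun v => IsUnit v.1.2)
  have s4 := Finset.card_filter_add_card_filter_not
    (s := (Z.filter fun v => ¬ IsUnit v.1.1).filter fun v => ¬ IsUnit v.1.2) (fun v => v.1.1 = 0)
  omega

end LocalDensity

section DensityBounds

/-- The integral forms satisfying `Q` lie in at most `k` residue classes modulo `M`. -/
def ClassBound (Q : (ℤ × ℤ) × (ℤ × ℤ) → Prop) (M k : ℕ) : Prop :=
  ∃ S : Finset ((ZMod M × ZMod M) × (ZMod M × ZMod M)), S.card ≤ k ∧ ∀ v, Q v → formMod M v ∈ S

theorem ClassBound.and {Q Q' : (ℤ × ℤ) × (ℤ × ℤ) → Prop} {M M' k k' : ℕ} [NeZero M] [NeZero M']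
    (h : M.Coprime M') (hQ : ClassBound Q M k) (hQ' : ClassBound Q' M' k') :
    ClassBound (fun v => Q v ∧ Q' v) (M * M') (k * k') := by
  classical
  obtain ⟨S, hS, hSQ⟩ := hQ
  obtain ⟨S', hS', hSQ'⟩ := hQ'
  set e := ZMod.chineseRemainder h with he
  set f : ((ZMod (M * M') × ZMod (M * M')) × (ZMod (M * M') × ZMod (M * M'))) →
      ((ZMod M × ZMod M) × (ZMod M × ZMod M)) × ((ZMod M' × ZMod M') × (ZMod M' × ZMod M')) :=
    fun r => ((((e r.1.1).1, (e r.1.2).1), ((e r.2.1).1, (e r.2.2).1)),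
      (((e r.1.1).2, (e r.1.2).2), ((e r.2.1).2, (e r.2.2).2))) with hf
  have hfinj : Function.Injective f := by
    rintro ⟨⟨a, b⟩, ⟨c, d⟩⟩ ⟨⟨a', b'⟩, ⟨c', d'⟩⟩ hr
    simp only [hf, Prod.mk.injEq] at hr
    obtain ⟨⟨⟨ha, hb⟩, hc, hd⟩, ⟨ha', hb'⟩, hc', hd'⟩ := hr
    rw [e.injective (Prod.ext ha ha'), e.injective (Prod.ext hb hb'),
      e.injective (Prod.ext hc hc'), e.injective (Prod.ext hd hd')]
  have hcast : ∀ n : ℤ, e (n : ZMod (M * M')) = ((n : ZMod M), (n : ZMod M')) := by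
    intro n
    rw [map_intCast]
    rfl
  refine ⟨(S ×ˢ S').preimage f hfinj.injOn, ?_, ?_⟩
  · refine (Finset.card_le_card_of_injOn f (t := S ×ˢ S') ?_ hfinj.injOn).trans ?_
    · intro r hr
      exact Finset.mem_preimage.1 hr
    · rw [Finset.card_product]
      gcongr
  · rintro v ⟨h1, h2⟩
    rw [Finset.mem_preimage, Finset.mem_product]
    have hfv : f (formMod (M * M') v) = (formMod M v, formMod M' v) := by
      simp only [hf, formMod, hcast]
    rw [hfv]
    exact ⟨hSQ v h1, hSQ' v h2⟩

theorem cubicDisc_formMod (M : ℕ) (v : (ℤ × ℤ) × (ℤ × ℤ)) :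
    cubicDisc (formMod M v) = ((cubicDisc v : ℤ) : ZMod M) := by
  simp only [cubicDisc, formMod]
  push_cast
  rfl

theorem classBound_sq_not_dvd {p : ℕ} (hp : p.Prime) (h2 : p ≠ 2) :
    ClassBound (fun v => ¬ ((p ^ 2 : ℕ) : ℤ) ∣ cubicDisc v) (p ^ 2) (p ^ 4 * (p ^ 2 - 1) ^ 2) := by
  have hp2 : 2 ≤ p := hp.two_le
  have hp2lt : 1 < p ^ 2 := by nlinarith
  have : Fact (1 < p ^ 2) := ⟨hp2lt⟩
  have : NeZero (p ^ 2) := ⟨by omega⟩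
  set P : Finset (ZMod (p ^ 2)) := (Finset.range p).image fun i => ((p * i : ℕ) : ZMod (p ^ 2))
    with hP
  have hPcard : P.card = p := by
    rw [hP, Finset.card_image_of_injOn, Finset.card_range]
    intro i hi j hj hij
    have hi' : i < p := by simpa using hi
    have hj' : j < p := by simpa using hj
    have h1 : p * i < p ^ 2 := by nlinarith
    have h2 : p * j < p ^ 2 := by nlinarith
    have := (ZMod.natCast_eq_natCast_iff' _ _ _).1 hij
    rw [Nat.mod_eq_of_lt h1, Nat.mod_eq_of_lt h2] at this
    exact Nat.eq_of_mul_eq_mul_left hp.pos this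
  have hP0 : (0 : ZMod (p ^ 2)) ∈ P :=
    Finset.mem_image.2 ⟨0, Finset.mem_range.2 hp.pos, by simp⟩
  have hPP : ∀ x ∈ P, ∀ y ∈ P, x * y = 0 := by
    intro x hx y hy
    obtain ⟨i, -, rfl⟩ := Finset.mem_image.1 hx
    obtain ⟨j, -, rfl⟩ := Finset.mem_image.1 hy
    rw [← Nat.cast_mul, ZMod.natCast_eq_zero_iff]
    exact ⟨i * j, by ring⟩
  have hunit2 : IsUnit (2 : ZMod (p ^ 2)) := by
    have := (ZMod.isUnit_iff_coprime 2 (p ^ 2)).2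
      (Nat.Coprime.pow_right 2 ((Nat.coprime_primes Nat.prime_two hp).2 (Ne.symm h2)))
    exact_mod_cast this
  have key := card_filter_cubicDisc_eq_zero_ge P hP0 hPP hunit2
  rw [hPcard, ZMod.card_units_eq_totient, ZMod.card, Nat.totient_prime_pow hp (by norm_num)] at key
  refine ⟨Finset.univ.filter fun v => ¬ cubicDisc v = 0, ?_, ?_⟩
  · have hs := Finset.card_filter_add_card_filter_not
      (s := (Finset.univ : Finset ((ZMod (p ^ 2) × ZMod (p ^ 2)) × (ZMod (p ^ 2) × ZMod (p ^ 2)))))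
      (fun v => cubicDisc v = 0)
    rw [Finset.card_univ] at hs
    simp only [Fintype.card_prod, ZMod.card] at hs
    obtain ⟨q, rfl⟩ : ∃ q, p = q + 1 := ⟨p - 1, by omega⟩
    have e1 : (q + 1) ^ 2 - 1 = q ^ 2 + 2 * q := by
      have : (q + 1) ^ 2 = q ^ 2 + 2 * q + 1 := by ring
      omega
    rw [e1]
    simp only [Nat.add_sub_cancel] at key
    zify at hs key ⊢
    norm_num at key
    nlinarith
  · intro v hv
    rw [Finset.mem_filter, cubicDisc_formMod, ZMod.intCast_zmod_eq_zero_iff_dvd]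
    exact ⟨Finset.mem_univ _, hv⟩

theorem classBound_three : ClassBound (fun v => cubicDisc v % 3 = 2) 3 24 := by
  refine ⟨Finset.univ.filter fun v => cubicDisc v = 2, ?_, ?_⟩
  · unfold cubicDisc
    decide +kernel
  · intro v hv
    rw [Finset.mem_filter, cubicDisc_formMod]
    refine ⟨Finset.mem_univ _, ?_⟩
    have : ((cubicDisc v : ℤ) : ZMod 3) = ((2 : ℤ) : ZMod 3) :=
      (ZMod.intCast_eq_intCast_iff' _ _ _).2 (by simpa using hv)
    exact_mod_cast this

theorem classBound_one_mod_four : ClassBound (fun v => cubicDisc v % 4 = 1) 4 96 := by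
  refine ⟨Finset.univ.filter fun v => cubicDisc v = 1, ?_, ?_⟩
  · unfold cubicDisc
    decide +kernel
  · intro v hv
    rw [Finset.mem_filter, cubicDisc_formMod]
    refine ⟨Finset.mem_univ _, ?_⟩
    have : ((cubicDisc v : ℤ) : ZMod 4) = ((1 : ℤ) : ZMod 4) :=
      (ZMod.intCast_eq_intCast_iff' _ _ _).2 (by simpa using hv)
    exact_mod_cast this

theorem classBound_mod_sixteen {s : ℤ} (hs : s = 2 ∨ s = 3) :
    ClassBound (fun v => cubicDisc v % 16 = 4 * s) 4 24 := by
  refine ⟨Finset.univ.filter fun v =>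
    (v.1.2 * v.2.1 - v.1.1 * v.2.2 = 0 ∧
      (v.1.2 ^ 2 - v.1.1 * v.2.1) * (v.2.1 ^ 2 - v.1.2 * v.2.2) = ((-s : ℤ) : ZMod 4)) ∨
    (v.1.2 * v.2.1 - v.1.1 * v.2.2 = 2 ∧
      (v.1.2 ^ 2 - v.1.1 * v.2.1) * (v.2.1 ^ 2 - v.1.2 * v.2.2) = ((1 - s : ℤ) : ZMod 4)), ?_, ?_⟩
  · rcases hs with rfl | rfl <;> decide +kernel
  · intro v hv
    rw [Finset.mem_filter]
    refine ⟨Finset.mem_univ _, ?_⟩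
    unfold cubicDisc at hv
    simp only [formMod]
    set B := v.1.2 * v.2.1 - v.1.1 * v.2.2 with hB
    set N := (v.1.2 ^ 2 - v.1.1 * v.2.1) * (v.2.1 ^ 2 - v.1.2 * v.2.2) with hN
    have hBc : ((v.1.2 : ZMod 4) * v.2.1 - v.1.1 * v.2.2) = (B : ZMod 4) := by
      rw [hB]
      push_cast
      ring
    have hNc : ((v.1.2 : ZMod 4) ^ 2 - v.1.1 * v.2.1) * ((v.2.1 : ZMod 4) ^ 2 - v.1.2 * v.2.2) =
        (N : ZMod 4) := by
      rw [hN]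
      push_cast
      ring
    rw [hBc, hNc]
    have hv' : (B ^ 2 - 4 * N) % 16 = 4 * s := by
      rw [hN, ← mul_assoc]
      exact hv
    have key : (B % 4 = 0 ∧ N % 4 = (-s) % 4) ∨ (B % 4 = 2 ∧ N % 4 = (1 - s) % 4) := by
      obtain ⟨j, hj | hj | hj | hj⟩ : ∃ j, B = 4 * j ∨ B = 4 * j + 1 ∨ B = 4 * j + 2 ∨
          B = 4 * j + 3 := ⟨B / 4, by omega⟩
      · have : B ^ 2 = 16 * (j * j) := by rw [hj]; ring
        rw [this] at hv'
        omega
      · have : B ^ 2 = 16 * (j * j) + 8 * j + 1 := by rw [hj]; ring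
        rw [this] at hv'
        omega
      · have : B ^ 2 = 16 * (j * j) + 16 * j + 4 := by rw [hj]; ring
        rw [this] at hv'
        omega
      · have : B ^ 2 = 16 * (j * j) + 24 * j + 9 := by rw [hj]; ring
        rw [this] at hv'
        omega
    rcases key with ⟨h1, h2⟩ | ⟨h1, h2⟩
    · left
      refine ⟨?_, (ZMod.intCast_eq_intCast_iff' _ _ _).2 (by exact_mod_cast h2)⟩
      rw [ZMod.intCast_zmod_eq_zero_iff_dvd]
      exact Int.dvd_of_emod_eq_zero h1
    · right
      refine ⟨?_, (ZMod.intCast_eq_intCast_iff' _ _ _).2 (by exact_mod_cast h2)⟩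
      have : ((B : ℤ) : ZMod 4) = ((2 : ℤ) : ZMod 4) :=
        (ZMod.intCast_eq_intCast_iff' _ _ _).2 (by exact_mod_cast h1)
      exact_mod_cast this

end DensityBounds

section SievedForms

/-- The primes `5 ≤ p ≤ Y`. -/
def primesFromFive (Y : ℕ) : Finset ℕ := (Nat.primesBelow (Y + 1)).filter (5 ≤ ·)

theorem mem_primesFromFive {Y p : ℕ} : p ∈ primesFromFive Y ↔ p.Prime ∧ 5 ≤ p ∧ p ≤ Y := by
  simp only [primesFromFive, Finset.mem_filter, Nat.mem_primesBelow]
  constructor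
  · rintro ⟨⟨h1, h2⟩, h3⟩
    exact ⟨h2, h3, by omega⟩
  · rintro ⟨h1, h2, h3⟩
    exact ⟨⟨by omega, h1⟩, h2⟩

/-- The density of the integers not divisible by `p²` for any prime `5 ≤ p ≤ Y`. -/
noncomputable def sieveDensity (Y : ℕ) : ℝ := ∏ p ∈ primesFromFive Y, (1 - ((p : ℝ) ^ 2)⁻¹)

theorem coprime_prod_sq {s : Finset ℕ} (hs : ∀ p ∈ s, p.Prime) {m : ℕ} (hm : ∀ p ∈ s, ¬ p ∣ m) :
    m.Coprime (∏ p ∈ s, p ^ 2) :=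
  Nat.Coprime.prod_right fun p hp =>
    Nat.Coprime.pow_right 2 (((hs p hp).coprime_iff_not_dvd.2 (hm p hp)).symm)

theorem neZero_prod_sq {s : Finset ℕ} (hs : ∀ p ∈ s, p.Prime) : NeZero (∏ p ∈ s, p ^ 2) :=
  ⟨Finset.prod_ne_zero_iff.2 fun p hp => pow_ne_zero 2 (hs p hp).ne_zero⟩

theorem classBound_prod_sq (s : Finset ℕ) (hs : ∀ p ∈ s, p.Prime ∧ p ≠ 2) :
    ClassBound (fun v => ∀ p ∈ s, ¬ ((p ^ 2 : ℕ) : ℤ) ∣ cubicDisc v) (∏ p ∈ s, p ^ 2)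
      (∏ p ∈ s, p ^ 4 * (p ^ 2 - 1) ^ 2) := by
  classical
  induction s using Finset.induction_on with
  | empty =>
    rw [Finset.prod_empty, Finset.prod_empty]
    exact ⟨Finset.univ, le_of_eq (by decide), fun _ _ => Finset.mem_univ _⟩
  | insert p s hps ih =>
    rw [Finset.prod_insert hps, Finset.prod_insert hps]
    have hp := hs p (Finset.mem_insert_self _ _)
    have hs' : ∀ q ∈ s, q.Prime ∧ q ≠ 2 := fun q hq => hs q (Finset.mem_insert_of_mem hq)
    have : NeZero (p ^ 2) := ⟨pow_ne_zero 2 hp.1.ne_zero⟩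
    have : NeZero (∏ p ∈ s, p ^ 2) := neZero_prod_sq fun q hq => (hs' q hq).1
    have hcop : (p ^ 2).Coprime (∏ p ∈ s, p ^ 2) := by
      refine coprime_prod_sq (fun q hq => (hs' q hq).1) fun q hq hd => hps ?_
      have := (Nat.prime_dvd_prime_iff_eq (hs' q hq).1 hp.1).1 ((hs' q hq).1.dvd_of_dvd_pow hd)
      exact this ▸ hq
    obtain ⟨S, hS, hSQ⟩ := (classBound_sq_not_dvd hp.1 hp.2).and hcop (ih hs')
    refine ⟨S, hS, fun v hv => hSQ v ⟨hv p (Finset.mem_insert_self _ _), fun q hq => ?_⟩⟩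
    exact hv q (Finset.mem_insert_of_mem hq)

theorem card_sieved_forms_le {q : ℤ → Prop} {k : ℕ} (hq : ClassBound (fun v => q (cubicDisc v)) 4 k)
    (Y : ℕ) {ε : ℝ} (hε : 0 < ε) :
    ∀ᶠ T : ℝ in Filter.atTop, ∀ F : Finset ((ℤ × ℤ) × (ℤ × ℤ)),
      (∀ v ∈ F, IsReducedForm v ∧ cubicDisc v < 0 ∧ ((-cubicDisc v : ℤ) : ℝ) ≤ T ^ 4 ∧
        q (cubicDisc v) ∧ cubicDisc v % 3 = 2 ∧
        ∀ p ∈ primesFromFive Y, ¬ ((p ^ 2 : ℕ) : ℤ) ∣ cubicDisc v) →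
      (F.card : ℝ) ≤ (π ^ 2 / 6 * (k / 256 * (8 / 27) * sieveDensity Y ^ 2) + ε) * T ^ 4 := by
  have hprime : ∀ p ∈ primesFromFive Y, p.Prime := fun p hp => (mem_primesFromFive.1 hp).1
  have hfive : ∀ p ∈ primesFromFive Y, 5 ≤ p := fun p hp => (mem_primesFromFive.1 hp).2.1
  have : NeZero (∏ p ∈ primesFromFive Y, p ^ 2) := neZero_prod_sq hprime
  have hcop : ∀ m, 0 < m → m < 5 → m.Coprime (∏ p ∈ primesFromFive Y, p ^ 2) := by
    intro m hm0 hm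
    refine coprime_prod_sq hprime fun p hp hd => ?_
    have := Nat.le_of_dvd hm0 hd
    have := hfive p hp
    omega
  have h3 := classBound_three.and (hcop 3 (by norm_num) (by norm_num))
    (classBound_prod_sq (primesFromFive Y) fun p hp => ⟨hprime p hp, by have := hfive p hp; omega⟩)
  obtain ⟨S, hS, hSQ⟩ := hq.and (Nat.Coprime.mul_right (by norm_num)
    (hcop 4 (by norm_num) (by norm_num))) h3
  have hSr : (S.card : ℝ) ≤
      k * (24 * ∏ p ∈ primesFromFive Y, (p : ℝ) ^ 4 * ((p : ℝ) ^ 2 - 1) ^ 2) := by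
    have e : ((k * (24 * ∏ p ∈ primesFromFive Y, p ^ 4 * (p ^ 2 - 1) ^ 2) : ℕ) : ℝ) =
        k * (24 * ∏ p ∈ primesFromFive Y, (p : ℝ) ^ 4 * ((p : ℝ) ^ 2 - 1) ^ 2) := by
      push_cast
      congr 2
      refine Finset.prod_congr rfl fun p hp => ?_
      rw [Nat.cast_sub (Nat.one_le_pow _ _ (hprime p hp).pos)]
      push_cast
      rfl
    rw [← e]
    exact_mod_cast hS
  have hdens : (S.card : ℝ) / ((4 * (3 * ∏ p ∈ primesFromFive Y, p ^ 2) : ℕ) : ℝ) ^ 4 ≤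
      k / 256 * (8 / 27) * sieveDensity Y ^ 2 := by
    rw [div_le_iff₀ (by have := NeZero.ne (∏ p ∈ primesFromFive Y, p ^ 2); positivity)]
    refine hSr.trans (le_of_eq ?_)
    have e : (∏ p ∈ primesFromFive Y, (p : ℝ) ^ 4 * ((p : ℝ) ^ 2 - 1) ^ 2) =
        sieveDensity Y ^ 2 * (∏ p ∈ primesFromFive Y, (p : ℝ) ^ 2) ^ 4 := by
      unfold sieveDensity
      rw [← Finset.prod_pow, ← Finset.prod_pow, ← Finset.prod_mul_distrib]
      refine Finset.prod_congr rfl fun p hp => ?_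
      have : (p : ℝ) ≠ 0 := by exact_mod_cast (hprime p hp).ne_zero
      field_simp
    rw [e]
    push_cast
    ring
  filter_upwards [card_reduced_forms_le (4 * (3 * ∏ p ∈ primesFromFive Y, p ^ 2)) hε] with T hT F hF
  refine (hT S F fun v hv => ?_).trans (by gcongr)
  obtain ⟨h1, h2, h3, h4, h5, h6⟩ := hF v hv
  exact ⟨h1, h2, h3, hSQ v ⟨h4, h5, h6⟩⟩

/-- Change the signs of `(a, b, c, d)` by multiplying the form by `σ` and substituting `τ y`
for `y`. -/
def signedForm (σ τ : ℤˣ) (v : (ℤ × ℤ) × (ℤ × ℤ)) : (ℤ × ℤ) × (ℤ × ℤ) :=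
  ((σ * v.1.1, σ * τ * v.1.2), (σ * v.2.1, σ * τ * v.2.2))

theorem cubicDisc_signedForm (σ τ : ℤˣ) (v : (ℤ × ℤ) × (ℤ × ℤ)) :
    cubicDisc (signedForm σ τ v) = cubicDisc v := by
  unfold cubicDisc signedForm
  rcases Int.units_eq_one_or σ with rfl | rfl <;> rcases Int.units_eq_one_or τ with rfl | rfl <;>
    push_cast <;> ring

theorem IsReducedForm.signedForm {v : (ℤ × ℤ) × (ℤ × ℤ)} (hv : IsReducedForm v) (σ τ : ℤˣ) :
    IsReducedForm (signedForm σ τ v) := by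
  obtain ⟨h1, h2, h3⟩ := hv
  rw [abs_le] at h2
  unfold IsReducedForm _root_.signedForm
  rw [abs_le]
  rcases Int.units_eq_one_or σ with rfl | rfl <;> rcases Int.units_eq_one_or τ with rfl | rfl <;>
    push_cast <;> refine ⟨by simpa using h1, ⟨?_, ?_⟩, ?_⟩ <;> nlinarith

theorem four_mul_card_disc_le {q : ℤ → Prop} {k : ℕ}
    (hq : ClassBound (fun v => q (cubicDisc v)) 4 k) (Y : ℕ) {ε : ℝ} (hε : 0 < ε) :
    ∀ᶠ T : ℝ in Filter.atTop, ∀ G : Finset ℤ,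
      (∀ Δ ∈ G, Δ < 0 ∧ ((-Δ : ℤ) : ℝ) ≤ T ^ 4 ∧ q Δ ∧ Δ % 3 = 2 ∧
        (∀ p : ℕ, p.Prime → 5 ≤ p → ¬ ((p ^ 2 : ℕ) : ℤ) ∣ Δ) ∧
        ∃ v, IsReducedForm v ∧ v.2.2 ≠ 0 ∧ cubicDisc v = Δ) →
      4 * (G.card : ℝ) ≤ (π ^ 2 / 6 * (k / 256 * (8 / 27) * sieveDensity Y ^ 2) + ε) * T ^ 4 := by
  filter_upwards [card_sieved_forms_le hq Y hε] with T hT G hG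
  choose! f hf1 hf2 hf3 using fun Δ hΔ => (hG Δ hΔ).2.2.2.2.2
  set g : ℤ × (ℤˣ × ℤˣ) → (ℤ × ℤ) × (ℤ × ℤ) := fun w => signedForm w.2.1 w.2.2 (f w.1) with hg
  have hinj : Set.InjOn g (G ×ˢ (Finset.univ : Finset (ℤˣ × ℤˣ)) : Finset _) := by
    rintro ⟨Δ, σ, τ⟩ h ⟨Δ', σ', τ'⟩ h' he
    have hΔ : Δ ∈ G := (Finset.mem_product.1 h).1
    have hΔ' : Δ' ∈ G := (Finset.mem_product.1 h').1
    have hd := congrArg cubicDisc he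
    simp only [hg, cubicDisc_signedForm] at hd
    rw [hf3 Δ hΔ, hf3 Δ' hΔ'] at hd
    subst hd
    simp only [hg, signedForm, Prod.mk.injEq] at he
    have hσ : σ = σ' := Units.ext (mul_right_cancel₀ (hf1 Δ hΔ).1 he.1.1)
    subst hσ
    have hτ : σ * τ = σ * τ' := Units.ext (by
      push_cast
      exact mul_right_cancel₀ (hf2 Δ hΔ) he.2.2)
    rw [mul_left_cancel hτ]
  have hcard : ((G ×ˢ (Finset.univ : Finset (ℤˣ × ℤˣ))).image g).card = 4 * G.card := by
    rw [Finset.card_image_of_injOn hinj, Finset.card_product, mul_comm]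
    rfl
  have key := hT ((G ×ˢ (Finset.univ : Finset (ℤˣ × ℤˣ))).image g) ?_
  · rw [hcard] at key
    exact_mod_cast key
  · intro v hv
    obtain ⟨⟨Δ, σ, τ⟩, h, rfl⟩ := Finset.mem_image.1 hv
    have hΔ : Δ ∈ G := (Finset.mem_product.1 h).1
    obtain ⟨h1, h2, h3, h4, h5, -⟩ := hG Δ hΔ
    simp only [hg, cubicDisc_signedForm, hf3 Δ hΔ]
    exact ⟨(hf1 Δ hΔ).signedForm σ τ, h1, h2, h3, h4, fun p hp =>
      h5 p (mem_primesFromFive.1 hp).1 (mem_primesFromFive.1 hp).2.1⟩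

end SievedForms

section Counting

/-- Some model of `ℚ(√-D)` inside `ℂ` has class number divisible by `3`. -/
def ThreeDvdClassNumber (D : ℤ) : Prop :=
  ∃ c : ℂ, c ^ 2 = -(D : ℂ) ∧ ∃ inst : NumberField ℚ⟮c⟯, 3 ∣ @NumberField.classNumber ℚ⟮c⟯ _ inst

theorem adjoin_simple_div_two (c : ℂ) : ℚ⟮c⟯ = ℚ⟮c / 2⟯ := by
  refine le_antisymm ?_ ?_
  · rw [adjoin_simple_le_iff]
    have h := add_mem (mem_adjoin_simple_self ℚ (c / 2)) (mem_adjoin_simple_self ℚ (c / 2))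
    rwa [add_halves] at h
  · rw [adjoin_simple_le_iff]
    exact div_mem (mem_adjoin_simple_self ℚ c) (ofNat_mem ℚ⟮c⟯ 2)

theorem ThreeDvdClassNumber.exists_form {D m : ℤ} (h : ThreeDvdClassNumber D) (hm : 0 < m)
    (hsq : Squarefree m) (hDm : D = m ∨ D = 4 * m) :
    ∃ v, IsReducedForm v ∧ v.2.2 ≠ 0 ∧ cubicDisc v = if m % 4 = 3 then -m else -4 * m := by
  obtain ⟨c, hc, inst, h3⟩ := h
  have key : ∃ w : ℂ, w ^ 2 = -(m : ℂ) ∧ ℚ⟮c⟯ = ℚ⟮w⟯ := by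
    rcases hDm with rfl | rfl
    · exact ⟨c, hc, rfl⟩
    · refine ⟨c / 2, ?_, adjoin_simple_div_two c⟩
      rw [div_pow, hc]
      push_cast
      ring
  obtain ⟨w, hw, hF⟩ := key
  obtain ⟨a, b, c', d, ha, hd, h1, h2, h⟩ :=
    exists_reduced_cubic_form_of_three_dvd_classNumber hm hsq hw hF h3
  exact ⟨((a, b), (c', d)), ⟨ha, h1, h2⟩, hd, h⟩

theorem Squarefree.not_prime_sq_dvd {m : ℤ} (hm : Squarefree m) {p : ℕ} (hp : p.Prime) :
    ¬ ((p ^ 2 : ℕ) : ℤ) ∣ m := by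
  intro h
  have h1 : (p : ℤ) * p ∣ m := by
    have : ((p ^ 2 : ℕ) : ℤ) = p * p := by push_cast; ring
    rwa [← this]
  exact (Nat.prime_iff_prime_int.1 hp).not_isUnit (hm _ h1)

theorem Squarefree.not_prime_sq_dvd_four_mul {m : ℤ} (hm : Squarefree m) {p : ℕ} (hp : p.Prime)
    (h5 : 5 ≤ p) : ¬ ((p ^ 2 : ℕ) : ℤ) ∣ -4 * m := by
  intro h
  refine hm.not_prime_sq_dvd hp ?_
  have hc : IsCoprime ((p ^ 2 : ℕ) : ℤ) (-4 : ℤ) := by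
    have : Nat.Coprime (p ^ 2) 4 := by
      refine Nat.Coprime.pow_left 2 ?_
      rw [hp.coprime_iff_not_dvd]
      intro h
      have := Nat.le_of_dvd (by norm_num) h
      obtain rfl | h5' := h5.eq_or_lt <;> omega
    have h4 : IsCoprime ((p ^ 2 : ℕ) : ℤ) ((4 : ℕ) : ℤ) := Nat.isCoprime_iff_coprime.2 this
    simpa using h4.neg_right
  exact hc.dvd_of_dvd_mul_left h

theorem four_mul_card_le_of_discriminants {q : ℤ → Prop} {k : ℕ}
    (hq : ClassBound (fun v => q (cubicDisc v)) 4 k) (Y : ℕ) {κ ε : ℝ} (hκ : 0 < κ) (hε : 0 < ε)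
    {f : ℤ → ℤ} (hf : Function.Injective f) :
    ∀ᶠ x : ℝ in Filter.atTop, ∀ G : Finset ℤ,
      (∀ D ∈ G, f D < 0 ∧ ((-f D : ℤ) : ℝ) ≤ κ * x ∧ q (f D) ∧ f D % 3 = 2 ∧
        (∀ p : ℕ, p.Prime → 5 ≤ p → ¬ ((p ^ 2 : ℕ) : ℤ) ∣ f D) ∧
        ∃ v, IsReducedForm v ∧ v.2.2 ≠ 0 ∧ cubicDisc v = f D) →
      4 * (G.card : ℝ) ≤ (π ^ 2 / 6 * (k / 256 * (8 / 27) * sieveDensity Y ^ 2) + ε) * (κ * x) := by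
  have ht : Filter.Tendsto (fun x : ℝ => (κ * x) ^ (1 / 4 : ℝ)) Filter.atTop Filter.atTop :=
    (tendsto_rpow_atTop (by norm_num)).comp (Filter.tendsto_id.const_mul_atTop hκ)
  filter_upwards [ht.eventually (four_mul_card_disc_le hq Y hε), Filter.eventually_ge_atTop 0]
    with x hx hx0 G hG
  have hT : ((κ * x) ^ (1 / 4 : ℝ)) ^ 4 = κ * x := by
    rw [← Real.rpow_natCast, ← Real.rpow_mul (by positivity)]
    norm_num
  have := hx (G.image f) ?_
  · rwa [hT, Finset.card_image_of_injective _ hf] at this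
  · intro Δ hΔ
    obtain ⟨D, hD, rfl⟩ := Finset.mem_image.1 hΔ
    rw [hT]
    exact hG D hD

theorem card_three_dvd_classNumber_le (Y : ℕ) {ε : ℝ} (hε : 0 < ε) :
    ∀ᶠ x : ℝ in Filter.atTop, ∀ G : Finset ℤ,
      (∀ D ∈ G, IsFundamentalDiscriminant D ∧ 0 < D ∧ (D : ℝ) < x ∧ D % 3 = 1 ∧
        ThreeDvdClassNumber D) →
      (G.card : ℝ) ≤ (π ^ 2 / 144 * sieveDensity Y ^ 2 + ε) * x := by
  have hε' : 0 < ε / 2 := by positivity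
  have h1 := four_mul_card_le_of_discriminants (q := fun Δ => Δ % 16 = 4 * 3)
    (classBound_mod_sixteen (Or.inr rfl)) Y (κ := 4) (by norm_num) hε'
    (f := fun D => -4 * D) (fun a b h => by simpa using h)
  have h2 := four_mul_card_le_of_discriminants (q := fun Δ => Δ % 4 = 1)
    classBound_one_mod_four Y (κ := 1 / 4) (by norm_num) hε'
    (f := fun m => -m) (fun a b h => by simpa using h)
  have h3 := four_mul_card_le_of_discriminants (q := fun Δ => Δ % 16 = 4 * 2)
    (classBound_mod_sixteen (Or.inl rfl)) Y (κ := 1) (by norm_num) hε'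
    (f := fun m => -4 * m) (fun a b h => by simpa using h)
  filter_upwards [h1, h2, h3, Filter.eventually_gt_atTop 0] with x h1 h2 h3 hx0 G hG
  classical
  set G1 := G.filter fun D => D % 4 = 1 with hG1
  set G2 := (G.filter fun D => D % 16 = 12).image (· / 4) with hG2
  set G3 := (G.filter fun D => D % 16 = 8).image (· / 4) with hG3
  have hpart : G.card ≤ G1.card + G2.card + G3.card := by
    have hc : ∀ s : Finset ℤ, (∀ D ∈ s, D % 4 = 0) → (s.image (· / 4)).card = s.card := by
      intro s hs
      refine Finset.card_image_of_injOn fun a ha b hb hab => ?_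
      have := hs a ha
      have := hs b hb
      omega
    rw [hG2, hG3, hc _ (fun D hD => by have := (Finset.mem_filter.1 hD).2; omega),
      hc _ (fun D hD => by have := (Finset.mem_filter.1 hD).2; omega)]
    refine le_trans (Finset.card_le_card ?_)
      ((Finset.card_union_le _ _).trans (Nat.add_le_add_right (Finset.card_union_le _ _) _))
    intro D hD
    have hfund := (hG D hD).1
    simp only [hG1, Finset.mem_union, Finset.mem_filter, hD, true_and]
    rcases hfund with ⟨h, -⟩ | ⟨m, h, -, hm⟩ <;> omega
  have hfour : ∀ D ∈ G, D % 4 = 0 → Squarefree (D / 4) ∧ D = 4 * (D / 4) := by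
    intro D hD h0
    rcases (hG D hD).1 with ⟨h, -⟩ | ⟨m, h, hsq, -⟩
    · omega
    · rw [h, Int.mul_ediv_cancel_left _ (by norm_num)]
      exact ⟨hsq, rfl⟩
  have b1 := h1 G1 ?_
  have b2 := h2 G2 ?_
  have b3 := h3 G3 ?_
  · have hpart' : (G.card : ℝ) ≤ G1.card + G2.card + G3.card := by exact_mod_cast hpart
    push_cast at b1 b2 b3
    have : 0 < ε * x := by positivity
    linarith
  · intro m hm
    obtain ⟨D, hD, rfl⟩ := Finset.mem_image.1 hm
    obtain ⟨hDG, hD8⟩ := Finset.mem_filter.1 hD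
    obtain ⟨-, hpos, hlt, hD3, h3c⟩ := hG D hDG
    obtain ⟨hsq, hDm⟩ := hfour D hDG (by omega)
    generalize D / 4 = m at hsq hDm
    subst hDm
    have hmpos : 0 < m := by omega
    refine ⟨by omega, ?_, by omega, by omega,
      fun p hp h5 => hsq.not_prime_sq_dvd_four_mul hp h5, ?_⟩
    · push_cast at hlt ⊢
      linarith
    · have := h3c.exists_form hmpos hsq (Or.inr rfl)
      rwa [if_neg (by omega)] at this
  · intro m hm
    obtain ⟨D, hD, rfl⟩ := Finset.mem_image.1 hm
    obtain ⟨hDG, hD8⟩ := Finset.mem_filter.1 hD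
    obtain ⟨-, hpos, hlt, hD3, h3c⟩ := hG D hDG
    obtain ⟨hsq, hDm⟩ := hfour D hDG (by omega)
    generalize D / 4 = m at hsq hDm
    subst hDm
    have hmpos : 0 < m := by omega
    refine ⟨by omega, ?_, by omega, by omega, fun p hp h5 => ?_, ?_⟩
    · push_cast at hlt ⊢
      linarith
    · rw [dvd_neg]
      exact hsq.not_prime_sq_dvd hp
    · have := h3c.exists_form hmpos hsq (Or.inr rfl)
      rwa [if_pos (by omega)] at this
  · intro D hD
    obtain ⟨hDG, hD4⟩ := Finset.mem_filter.1 hD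
    obtain ⟨hfund, hpos, hlt, hD3, h3c⟩ := hG D hDG
    have hsq : Squarefree D := by
      rcases hfund with ⟨-, h⟩ | ⟨m, h, -, -⟩
      · exact h
      · omega
    refine ⟨by omega, ?_, by omega, by omega,
      fun p hp h5 => hsq.not_prime_sq_dvd_four_mul hp h5, ?_⟩
    · push_cast
      linarith
    · have := h3c.exists_form hpos hsq (Or.inl rfl)
      rwa [if_neg (by omega)] at this

end Counting

section SquarefreeCount

/-- The natural numbers satisfying `Q` contain at least `k` full residue classes modulo `M`. -/
def ContainsClasses (Q : ℕ → Prop) (M k : ℕ) : Prop :=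
  ∃ S : Finset (ZMod M), k ≤ S.card ∧ ∀ n : ℕ, (n : ZMod M) ∈ S → Q n

theorem ContainsClasses.and {Q Q' : ℕ → Prop} {M M' k k' : ℕ} (h : M.Coprime M')
    (hQ : ContainsClasses Q M k) (hQ' : ContainsClasses Q' M' k') :
    ContainsClasses (fun n => Q n ∧ Q' n) (M * M') (k * k') := by
  classical
  obtain ⟨S, hS, hSQ⟩ := hQ
  obtain ⟨S', hS', hSQ'⟩ := hQ'
  set e := ZMod.chineseRemainder h with he
  refine ⟨(S ×ˢ S').map e.symm.toEquiv.toEmbedding, ?_, fun n hn => ?_⟩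
  · rw [Finset.card_map, Finset.card_product]
    gcongr
  · obtain ⟨y, hy, hyn⟩ := Finset.mem_map.1 hn
    have : y = ((n : ZMod M), (n : ZMod M')) := by
      have h1 : e.symm y = (n : ZMod (M * M')) := hyn
      rw [RingEquiv.symm_apply_eq, map_natCast] at h1
      exact h1
    subst this
    obtain ⟨h1, h2⟩ := Finset.mem_product.1 hy
    exact ⟨hSQ n h1, hSQ' n h2⟩

theorem containsClasses_mod {M r : ℕ} (hr : r < M) : ContainsClasses (fun n => n % M = r) M 1 := by
  refine ⟨{(r : ZMod M)}, by simp, fun n hn => ?_⟩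
  rw [Finset.mem_singleton, ZMod.natCast_eq_natCast_iff', Nat.mod_eq_of_lt hr] at hn
  exact hn

theorem containsClasses_not_dvd (M : ℕ) [NeZero M] :
    ContainsClasses (fun n => ¬ M ∣ n) M (M - 1) := by
  refine ⟨Finset.univ.erase 0, ?_, fun n hn => ?_⟩
  · rw [Finset.card_erase_of_mem (Finset.mem_univ _), Finset.card_univ, ZMod.card]
  · change ¬ M ∣ n
    rw [← ZMod.natCast_eq_zero_iff]
    exact (Finset.mem_erase.1 hn).1

theorem containsClasses_prod_sq (s : Finset ℕ) (hs : ∀ p ∈ s, p.Prime) :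
    ContainsClasses (fun n => ∀ p ∈ s, ¬ p ^ 2 ∣ n) (∏ p ∈ s, p ^ 2) (∏ p ∈ s, (p ^ 2 - 1)) := by
  classical
  induction s using Finset.induction_on with
  | empty =>
    rw [Finset.prod_empty, Finset.prod_empty]
    exact ⟨Finset.univ, le_of_eq (by decide), by simp⟩
  | insert p s hps ih =>
    rw [Finset.prod_insert hps, Finset.prod_insert hps]
    have hp := hs p (Finset.mem_insert_self _ _)
    have hs' : ∀ q ∈ s, q.Prime := fun q hq => hs q (Finset.mem_insert_of_mem hq)
    have : NeZero (p ^ 2) := ⟨pow_ne_zero 2 hp.ne_zero⟩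
    have hcop : (p ^ 2).Coprime (∏ p ∈ s, p ^ 2) := by
      refine coprime_prod_sq hs' fun q hq hd => hps ?_
      have := (Nat.prime_dvd_prime_iff_eq (hs' q hq) hp).1 ((hs' q hq).dvd_of_dvd_pow hd)
      exact this ▸ hq
    obtain ⟨S, hS, hSQ⟩ := (containsClasses_not_dvd (p ^ 2)).and hcop (ih hs')
    refine ⟨S, hS, fun n hn q hq => ?_⟩
    rcases Finset.mem_insert.1 hq with rfl | hq
    · exact (hSQ n hn).1
    · exact (hSQ n hn).2 q hq

theorem ContainsClasses.le_card {Q : ℕ → Prop} [DecidablePred Q] {M k : ℕ} [NeZero M]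
    (hQ : ContainsClasses Q M k) (X : ℕ) :
    k * (X / M) ≤ ((Finset.range X).filter Q).card := by
  obtain ⟨S, hS, hSQ⟩ := hQ
  have hM : 0 < M := NeZero.pos M
  calc k * (X / M) ≤ (S ×ˢ Finset.range (X / M)).card := by
        rw [Finset.card_product, Finset.card_range]
        gcongr
    _ ≤ _ := by
        refine Finset.card_le_card_of_injOn (fun y => y.1.val + M * y.2) ?_ ?_
        · rintro ⟨r, j⟩ hy
          obtain ⟨hr, hj⟩ := Finset.mem_product.1 hy
          have hlt := ZMod.val_lt r
          have hj' : j + 1 ≤ X / M := Finset.mem_range.1 hj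
          have h1 : M * (j + 1) ≤ X := (Nat.mul_le_mul_left M hj').trans (Nat.mul_div_le X M)
          refine Finset.mem_coe.2 (Finset.mem_filter.2 ⟨Finset.mem_range.2 ?_, hSQ _ ?_⟩)
          · simp only
            linarith
          · simpa using hr
        · rintro ⟨r, j⟩ - ⟨r', j'⟩ - h
          simp only at h
          have hlt := ZMod.val_lt r
          have hlt' := ZMod.val_lt r'
          have h1 := congrArg (· / M) h
          have h2 := congrArg (· % M) h
          simp only [Nat.add_mul_div_left _ _ hM, Nat.div_eq_of_lt hlt, Nat.div_eq_of_lt hlt',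
            Nat.add_mul_mod_self_left, Nat.mod_eq_of_lt hlt, Nat.mod_eq_of_lt hlt', zero_add]
            at h1 h2
          rw [h1, ZMod.val_injective M h2]

open Classical in
theorem card_exists_sq_dvd_le {X Y : ℕ} (hY : Y ≠ 0) :
    (((Finset.range X).filter fun n => 0 < n ∧ ∃ k, Y < k ∧ k ^ 2 ∣ n).card : ℝ) ≤ X / Y := by
  rcases le_or_gt X Y with hXY | hXY
  · rw [Finset.filter_false_of_mem]
    · simp only [Finset.card_empty, Nat.cast_zero]
      positivity
    · rintro n hn ⟨h0, k, hk, hd⟩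
      have := Nat.le_of_dvd h0 hd
      have := Finset.mem_range.1 hn
      nlinarith
  have hsub : ((Finset.range X).filter fun n => 0 < n ∧ ∃ k, Y < k ∧ k ^ 2 ∣ n) ⊆
      (Finset.Ioc Y X).biUnion fun k => (Finset.Ioc 0 X).filter (k ^ 2 ∣ ·) := by
    intro n hn
    obtain ⟨hX, h0, k, hk, hd⟩ := Finset.mem_filter.1 hn
    have hX' := Finset.mem_range.1 hX
    have := Nat.le_of_dvd h0 hd
    exact Finset.mem_biUnion.2 ⟨k, Finset.mem_Ioc.2 ⟨hk, by nlinarith⟩,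
      Finset.mem_filter.2 ⟨Finset.mem_Ioc.2 ⟨h0, hX'.le⟩, hd⟩⟩
  have h1 := (Finset.card_le_card hsub).trans Finset.card_biUnion_le
  have h2 : ((∑ k ∈ Finset.Ioc Y X, ((Finset.Ioc 0 X).filter (k ^ 2 ∣ ·)).card : ℕ) : ℝ) ≤
      ∑ k ∈ Finset.Ioc Y X, X * ((k : ℝ) ^ 2)⁻¹ := by
    rw [Nat.cast_sum]
    refine Finset.sum_le_sum fun k _ => ?_
    rw [Nat.Ioc_filter_dvd_card_eq_div]
    refine Nat.cast_div_le.trans (le_of_eq ?_)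
    push_cast
    rw [div_eq_mul_inv]
  rw [← Finset.mul_sum] at h2
  have h3 : ∑ k ∈ Finset.Ioc Y X, ((k : ℝ) ^ 2)⁻¹ ≤ (Y : ℝ)⁻¹ :=
    (sum_Ioc_inv_sq_le_sub hY hXY.le).trans (sub_le_self _ (by positivity))
  rw [div_eq_mul_inv]
  exact ((Nat.cast_le.2 h1).trans h2).trans (by gcongr)

theorem squarefree_of_forall_prime_sq_not_dvd {n : ℕ} (h : ∀ p : ℕ, p.Prime → ¬ p ^ 2 ∣ n) :
    Squarefree n := by
  rw [Nat.squarefree_iff_prime_squarefree]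
  intro p hp hd
  exact h p hp (by rwa [sq])

theorem sub_le_card_squarefree {Y r : ℕ} (hY : Y ≠ 0) (hr : r = 1 ∨ r = 7 ∨ r = 10) :
    ∃ C : ℝ, ∀ X : ℕ, (sieveDensity Y / 12 - (Y : ℝ)⁻¹) * X - C ≤
      ((Finset.range X).filter fun n => n % 12 = r ∧ Squarefree n).card := by
  classical
  have hprime : ∀ p ∈ primesFromFive Y, p.Prime := fun p hp => (mem_primesFromFive.1 hp).1
  have : NeZero (∏ p ∈ primesFromFive Y, p ^ 2) := neZero_prod_sq hprime
  have hcop : Nat.Coprime 12 (∏ p ∈ primesFromFive Y, p ^ 2) := by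
    refine coprime_prod_sq hprime fun p hp hd => ?_
    have h5 := (mem_primesFromFive.1 hp).2.1
    have h1 : p ∣ 2 ^ 2 * 3 := hd
    rcases (hprime p hp).dvd_mul.1 h1 with h | h
    · have := Nat.le_of_dvd (by norm_num) ((hprime p hp).dvd_of_dvd_pow h)
      omega
    · have := Nat.le_of_dvd (by norm_num) h
      omega
  have hcc := (containsClasses_mod (M := 12) (r := r) (by omega)).and hcop
    (containsClasses_prod_sq (primesFromFive Y) hprime)
  rw [one_mul] at hcc
  set k := ∏ p ∈ primesFromFive Y, (p ^ 2 - 1) with hk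
  set N := 12 * ∏ p ∈ primesFromFive Y, p ^ 2 with hN
  have : NeZero N := ⟨mul_ne_zero (by norm_num) (NeZero.ne _)⟩
  have hN0 : (0 : ℝ) < N := Nat.cast_pos.2 (NeZero.pos N)
  have hdens : (k : ℝ) / N = sieveDensity Y / 12 := by
    rw [hk, hN, sieveDensity]
    push_cast
    rw [mul_comm, ← div_div, ← Finset.prod_div_distrib]
    congr 1
    refine Finset.prod_congr rfl fun p hp => ?_
    have hp0 : (p : ℝ) ≠ 0 := Nat.cast_ne_zero.2 (hprime p hp).ne_zero
    rw [Nat.cast_sub (Nat.one_le_pow _ _ (hprime p hp).pos)]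
    push_cast
    field_simp
  refine ⟨k, fun X => ?_⟩
  have h1 := hcc.le_card X
  have h2 := card_exists_sq_dvd_le (X := X) hY
  have hsub : ((Finset.range X).filter fun n => n % 12 = r ∧ ∀ p ∈ primesFromFive Y, ¬ p ^ 2 ∣ n) ⊆
      ((Finset.range X).filter fun n => n % 12 = r ∧ Squarefree n) ∪
        ((Finset.range X).filter fun n => 0 < n ∧ ∃ k, Y < k ∧ k ^ 2 ∣ n) := by
    intro n hn
    obtain ⟨hX, hnr, hp⟩ := Finset.mem_filter.1 hn
    rw [Finset.mem_union, Finset.mem_filter, Finset.mem_filter]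
    by_cases hsq : Squarefree n
    · exact Or.inl ⟨hX, hnr, hsq⟩
    · refine Or.inr ⟨hX, by omega, ?_⟩
      by_contra! hcon
      refine hsq (squarefree_of_forall_prime_sq_not_dvd fun p hpp hd => ?_)
      rcases lt_or_ge p 5 with h5 | h5
      · have : p = 2 ∨ p = 3 := by
          have := hpp.two_le
          have : p ≠ 4 := by rintro rfl; norm_num at hpp
          omega
        rcases this with rfl | rfl <;> omega
      · rcases lt_or_ge Y p with hYp | hYp
        · exact hcon p hYp hd
        · exact hp p (mem_primesFromFive.2 ⟨hpp, h5, hYp⟩) hd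
  have h3 := (Finset.card_le_card hsub).trans (Finset.card_union_le _ _)
  have h4 : ((k * (X / N) : ℕ) : ℝ) ≤
      ((Finset.range X).filter fun n => n % 12 = r ∧ Squarefree n).card +
        ((Finset.range X).filter fun n => 0 < n ∧ ∃ k, Y < k ∧ k ^ 2 ∣ n).card := by
    exact_mod_cast h1.trans h3
  have h5 : (X : ℝ) / N - 1 ≤ ((X / N : ℕ) : ℝ) := by
    have : (X : ℝ) / N < ((X / N : ℕ) : ℝ) + 1 := by
      rw [← Nat.floor_div_eq_div (K := ℝ)]
      exact Nat.lt_floor_add_one _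
    linarith
  have h6 : (k : ℝ) * (X / N - 1) ≤ ((k * (X / N) : ℕ) : ℝ) := by
    push_cast
    gcongr
  have h7 : (k : ℝ) * (X / N) = sieveDensity Y / 12 * X := by
    rw [← hdens]
    ring
  rw [div_eq_mul_inv] at h2
  linarith

end SquarefreeCount

section MainTerm

theorem sieveDensity_eq {Y : ℕ} (hY : 3 ≤ Y) :
    sieveDensity Y = 3 / 2 * ∏ p ∈ Nat.primesBelow (Y + 1), (1 - ((p : ℝ) ^ 2)⁻¹) := by
  rw [← Finset.prod_filter_mul_prod_filter_not (Nat.primesBelow (Y + 1)) (5 ≤ ·)]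
  have h : (Nat.primesBelow (Y + 1)).filter (fun p => ¬ 5 ≤ p) = {2, 3} := by
    ext p
    simp only [Finset.mem_filter, Nat.mem_primesBelow, Finset.mem_insert, Finset.mem_singleton]
    constructor
    · rintro ⟨⟨-, hp⟩, h5⟩
      have := hp.two_le
      have : p ≠ 4 := by rintro rfl; norm_num at hp
      omega
    · rintro (rfl | rfl)
      · exact ⟨⟨by omega, Nat.prime_two⟩, by omega⟩
      · exact ⟨⟨by omega, Nat.prime_three⟩, by omega⟩
  rw [h, Finset.prod_pair (by norm_num), sieveDensity, primesFromFive]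
  push_cast
  ring

theorem tendsto_sieveDensity :
    Filter.Tendsto sieveDensity Filter.atTop (nhds (9 / π ^ 2)) := by
  have h1 := riemannZeta_eulerProduct (s := 2) (by norm_num)
  rw [riemannZeta_two] at h1
  have h2 := (Complex.continuous_re.tendsto _).comp h1
  have e1 : ((π : ℂ) ^ 2 / 6).re = π ^ 2 / 6 := by
    have : (π : ℂ) ^ 2 / 6 = ((π ^ 2 / 6 : ℝ) : ℂ) := by push_cast; rfl
    rw [this, Complex.ofReal_re]
  have e2 : ∀ n : ℕ, (∏ p ∈ Nat.primesBelow n, (1 - (p : ℂ) ^ (-2 : ℂ))⁻¹).re =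
      (∏ p ∈ Nat.primesBelow n, (1 - ((p : ℝ) ^ 2)⁻¹))⁻¹ := by
    intro n
    have : ∏ p ∈ Nat.primesBelow n, (1 - (p : ℂ) ^ (-2 : ℂ))⁻¹ =
        (((∏ p ∈ Nat.primesBelow n, (1 - ((p : ℝ) ^ 2)⁻¹))⁻¹ : ℝ) : ℂ) := by
      rw [← Finset.prod_inv_distrib]
      push_cast
      refine Finset.prod_congr rfl fun p _ => ?_
      rw [Complex.cpow_neg]
      norm_num
    rw [this, Complex.ofReal_re]
  have h3 : Filter.Tendsto (fun n => (∏ p ∈ Nat.primesBelow n, (1 - ((p : ℝ) ^ 2)⁻¹))⁻¹)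
      Filter.atTop (nhds (π ^ 2 / 6)) := by
    rw [e1] at h2
    exact h2.congr e2
  have h4 := (h3.inv₀ (by positivity)).comp (Filter.tendsto_add_atTop_nat 1)
  have h5 := (h4.const_mul (3 / 2 : ℝ))
  have e3 : (3 / 2 : ℝ) * (π ^ 2 / 6)⁻¹ = 9 / π ^ 2 := by
    field_simp
    norm_num
  rw [e3] at h5
  refine h5.congr' ?_
  filter_upwards [Filter.eventually_ge_atTop 3] with Y hY
  simp only [Function.comp_apply, inv_inv]
  exact (sieveDensity_eq hY).symm

theorem sub_le_card_squarefree_ceil {Y r : ℕ} (hY : Y ≠ 0) (hr : r = 1 ∨ r = 7 ∨ r = 10) :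
    ∃ C : ℝ, ∀ x : ℝ, 0 ≤ x → (sieveDensity Y / 12 - (Y : ℝ)⁻¹) * x - C ≤
      ((Finset.range ⌈x⌉₊).filter fun n => n % 12 = r ∧ Squarefree n).card := by
  obtain ⟨C, hC⟩ := sub_le_card_squarefree hY hr
  refine ⟨C + |sieveDensity Y / 12 - (Y : ℝ)⁻¹|, fun x hx => ?_⟩
  refine le_trans ?_ (hC ⌈x⌉₊)
  set κ := sieveDensity Y / 12 - (Y : ℝ)⁻¹
  have h1 := Nat.le_ceil x
  have h2 := (Nat.ceil_lt_add_one hx).le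
  have h3 : |κ * (⌈x⌉₊ - x)| ≤ |κ| * 1 := by
    rw [abs_mul]
    refine mul_le_mul_of_nonneg_left ?_ (abs_nonneg _)
    rw [abs_le]
    constructor <;> linarith
  have := (abs_le.1 h3).1
  linarith

open Classical in
theorem sub_le_card_fundamentalDiscriminants {Y : ℕ} (hY : Y ≠ 0) :
    ∃ C : ℝ, ∀ x : ℝ, 0 ≤ x → (sieveDensity Y / 8 - 2 * (Y : ℝ)⁻¹) * x - C ≤
      ((Finset.Ioo 0 ⌈x⌉).filter fun D => IsFundamentalDiscriminant D ∧ D % 3 = 1).card := by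
  obtain ⟨C₁, h₁⟩ := sub_le_card_squarefree_ceil (r := 1) hY (by norm_num)
  obtain ⟨C₂, h₂⟩ := sub_le_card_squarefree_ceil (r := 7) hY (by norm_num)
  obtain ⟨C₃, h₃⟩ := sub_le_card_squarefree_ceil (r := 10) hY (by norm_num)
  refine ⟨C₁ + C₂ + C₃, fun x hx => ?_⟩
  have h₁ := h₁ x hx
  have h₂ := h₂ (x / 4) (by positivity)
  have h₃ := h₃ (x / 4) (by positivity)
  set A := fun (y : ℝ) (r : ℕ) => (Finset.range ⌈y⌉₊).filter fun n => n % 12 = r ∧ Squarefree n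
    with hA
  have hmem : ∀ y r n, n ∈ A y r ↔ (n : ℝ) < y ∧ n % 12 = r ∧ Squarefree n := by
    intro y r n
    rw [hA, Finset.mem_filter, Finset.mem_range, Nat.lt_ceil]
  set i : ℕ → ℤ := fun n => n with hi
  set j : ℕ → ℤ := fun n => 4 * n with hj
  have hi' : Function.Injective i := fun a b h => by simpa [hi] using h
  have hj' : Function.Injective j := fun a b h => by simpa [hj] using h
  have hd₁ : Disjoint ((A x 1).image i) ((A (x / 4) 7).image j) := by
    rw [Finset.disjoint_left]
    intro D h h'
    obtain ⟨n, hn, rfl⟩ := Finset.mem_image.1 h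
    obtain ⟨m, hm, hmn⟩ := Finset.mem_image.1 h'
    have := ((hmem _ _ _).1 hn).2.1
    simp only [hi, hj] at hmn
    omega
  have hd₂ : Disjoint ((A x 1).image i ∪ (A (x / 4) 7).image j) ((A (x / 4) 10).image j) := by
    rw [Finset.disjoint_left]
    intro D h h'
    obtain ⟨m, hm, rfl⟩ := Finset.mem_image.1 h'
    have hm' := ((hmem _ _ _).1 hm).2.1
    rcases Finset.mem_union.1 h with h | h
    · obtain ⟨n, hn, hmn⟩ := Finset.mem_image.1 h
      have := ((hmem _ _ _).1 hn).2.1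
      simp only [hi, hj] at hmn
      omega
    · obtain ⟨n, hn, hmn⟩ := Finset.mem_image.1 h
      have := ((hmem _ _ _).1 hn).2.1
      simp only [hj] at hmn
      omega
  have hsub : (A x 1).image i ∪ (A (x / 4) 7).image j ∪ (A (x / 4) 10).image j ⊆
      (Finset.Ioo 0 ⌈x⌉).filter fun D => IsFundamentalDiscriminant D ∧ D % 3 = 1 := by
    have hfour : ∀ r n, r = 7 ∨ r = 10 → n ∈ A (x / 4) r →
        j n ∈ (Finset.Ioo 0 ⌈x⌉).filter fun D => IsFundamentalDiscriminant D ∧ D % 3 = 1 := by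
      intro r n hr hn
      obtain ⟨hlt, hmod, hsq⟩ := (hmem _ _ _).1 hn
      rw [Finset.mem_filter, Finset.mem_Ioo, Int.lt_ceil]
      refine ⟨⟨by simp only [hj]; omega, ?_⟩, Or.inr ⟨n, rfl, Int.squarefree_natCast.2 hsq, ?_⟩, ?_⟩
      · simp only [hj]
        push_cast
        linarith
      · omega
      · simp only [hj]
        omega
    intro D hD
    rcases Finset.mem_union.1 hD with hD | hD
    · rcases Finset.mem_union.1 hD with hD | hD
      · obtain ⟨n, hn, rfl⟩ := Finset.mem_image.1 hD
        obtain ⟨hlt, hmod, hsq⟩ := (hmem _ _ _).1 hn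
        rw [Finset.mem_filter, Finset.mem_Ioo, Int.lt_ceil]
        refine ⟨⟨by simp only [hi]; omega, by simpa [hi] using hlt⟩,
          Or.inl ⟨by simp only [hi]; omega, Int.squarefree_natCast.2 hsq⟩, by simp only [hi]; omega⟩
      · obtain ⟨n, hn, rfl⟩ := Finset.mem_image.1 hD
        exact hfour 7 n (by norm_num) hn
    · obtain ⟨n, hn, rfl⟩ := Finset.mem_image.1 hD
      exact hfour 10 n (by norm_num) hn
  have hcard := Finset.card_le_card hsub
  rw [Finset.card_union_of_disjoint hd₂, Finset.card_union_of_disjoint hd₁,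
    Finset.card_image_of_injective _ hi', Finset.card_image_of_injective _ hj',
    Finset.card_image_of_injective _ hj'] at hcard
  refine le_trans ?_ (Nat.cast_le.2 hcard)
  push_cast
  have : 0 ≤ (Y : ℝ)⁻¹ * x := by positivity
  linarith

end MainTerm

theorem class_number_indivisibility_density (ε : ℝ) (hε : 0 < ε) :
    ∃ x₀ : ℝ, 0 < x₀ ∧ ∀ x : ℝ, x₀ ≤ x →
      (9 / (16 * π ^ 2) - ε) * x ≤
        (({D : ℤ | IsFundamentalDiscriminant D ∧ 0 < D ∧ (D : ℝ) < x ∧ D % 3 = 1 ∧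
          ∀ c : ℂ, c ^ 2 = -(D : ℂ) →
            ∀ inst : NumberField ℚ⟮c⟯,
              ¬ (3 ∣ @NumberField.classNumber ℚ⟮c⟯ _ inst)} : Set ℤ).ncard : ℝ) := by
  classical
  have hlim : Filter.Tendsto (fun Y : ℕ => sieveDensity Y / 8 - 2 * (Y : ℝ)⁻¹ -
      π ^ 2 / 144 * sieveDensity Y ^ 2) Filter.atTop (nhds (9 / (16 * π ^ 2))) := by
    have h := ((tendsto_sieveDensity.div_const 8).sub
      (tendsto_inv_atTop_nhds_zero_nat.const_mul (2 : ℝ))).sub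
        ((tendsto_sieveDensity.pow 2).const_mul (π ^ 2 / 144))
    convert h using 2
    field_simp
    norm_num
  obtain ⟨Y, hYε, hY⟩ := ((hlim.eventually (lt_mem_nhds (show 9 / (16 * π ^ 2) - ε / 3 <
    9 / (16 * π ^ 2) by linarith))).and (Filter.eventually_ne_atTop 0)).exists
  obtain ⟨C, hC⟩ := sub_le_card_fundamentalDiscriminants hY
  obtain ⟨x₁, hx₁⟩ := Filter.eventually_atTop.1
    ((card_three_dvd_classNumber_le Y (show 0 < ε / 3 by positivity)).and
      ((Filter.tendsto_id.const_mul_atTop (show 0 < ε / 3 by positivity)).eventually_ge_atTop C))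
  refine ⟨max x₁ 1, by positivity, fun x hx => ?_⟩
  have hx0 : 0 ≤ x := zero_le_one.trans ((le_max_right _ _).trans hx)
  obtain ⟨hbad, hCx⟩ := hx₁ x ((le_max_left _ _).trans hx)
  have hall := hC x hx0
  set S := {D : ℤ | IsFundamentalDiscriminant D ∧ 0 < D ∧ (D : ℝ) < x ∧ D % 3 = 1 ∧
    ∀ c : ℂ, c ^ 2 = -(D : ℂ) → ∀ inst : NumberField ℚ⟮c⟯,
      ¬ (3 ∣ @NumberField.classNumber ℚ⟮c⟯ _ inst)} with hS
  set U := (Finset.Ioo 0 ⌈x⌉).filter fun D => IsFundamentalDiscriminant D ∧ D % 3 = 1 with hU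
  have hmemU : ∀ D, D ∈ U ↔ (0 < D ∧ (D : ℝ) < x) ∧ IsFundamentalDiscriminant D ∧ D % 3 = 1 := by
    intro D
    rw [hU, Finset.mem_filter, Finset.mem_Ioo, Int.lt_ceil]
  have hSU : S = ↑(U.filter fun D => ¬ ThreeDvdClassNumber D) := by
    ext D
    rw [Finset.mem_coe, Finset.mem_filter, hmemU, hS, Set.mem_ofPred_eq, ThreeDvdClassNumber]
    push Not
    tauto
  rw [hSU, Set.ncard_coe_finset]
  have hsplit := Finset.card_filter_add_card_filter_not (s := U) ThreeDvdClassNumber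
  have hb := hbad (U.filter ThreeDvdClassNumber) fun D hD => by
    obtain ⟨hDU, h3⟩ := Finset.mem_filter.1 hD
    obtain ⟨⟨h1, h2⟩, h4, h5⟩ := (hmemU D).1 hDU
    exact ⟨h4, h1, h2, h5, h3⟩
  have hsplit' : ((U.filter ThreeDvdClassNumber).card : ℝ) +
      (U.filter fun D => ¬ ThreeDvdClassNumber D).card = U.card := by exact_mod_cast hsplit
  have hmain := mul_le_mul_of_nonneg_right hYε.le hx0
  simp only [id_eq] at hCx
  linarith
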